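/- arXiv:2408.12785 — 3 statements merged into one kernel-verified Lean document; each statement's English description precedes it below -/
import Mathlib

section
/- Let A ⊆ ℕ. The following are equivalent: (1) A is dynamically thick; (2) for every B ⊆ ℕ with A ⊆ B and B ≠ ℕ there exists a finite set F ⊆ ℕ ∖ B such that the set B − F is thick; (3) for every piecewise syndetic set S ⊆ ℕ there exists a finite set F ⊆ A such that the set S − F is thick. -/
open Set

/-- `A − n` computed inside the positive integers. -/
def shiftN (A : Set ℕ+) (n : ℕ+) : Set ℕ+ := {m : ℕ+ | m + n ∈ A}

/-- `A − B := ⋃_{b ∈ B} (A − b)`. -/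
def shiftSet (A B : Set ℕ+) : Set ℕ+ := ⋃ b ∈ B, shiftN A b

/-- A set of positive integers is syndetic if `A ∪ (A−1) ∪ ⋯ ∪ (A−N) = ℕ` for some `N`. -/
def Syndetic (A : Set ℕ+) : Prop :=
  ∃ N : ℕ+, (A ∪ ⋃ k ∈ {k : ℕ+ | k ≤ N}, shiftN A k) = Set.univ

/-- A set of positive integers is thick if it contains a translate of every finite set. -/
def Thick (A : Set ℕ+) : Prop :=
  ∀ F : Finset ℕ+, ∃ n : ℕ+, ∀ f ∈ F, f + n ∈ A

/-- Piecewise syndetic: some finite union of translates `A ∪ (A−1) ∪ ⋯ ∪ (A−N)` is thick. -/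
def PiecewiseSyndetic (A : Set ℕ+) : Prop :=
  ∃ N : ℕ+, Thick (A ∪ ⋃ k ∈ {k : ℕ+ | k ≤ N}, shiftN A k)

/-- A self-map of a topological space is minimal if every forward orbit
`{T^n x | n ∈ ℕ, n ≥ 1}` is dense. -/
def MinimalMap {X : Type} [TopologicalSpace X] (T : X → X) : Prop :=
  ∀ x : X, Dense (Set.range fun n : ℕ+ => T^[(n : ℕ)] x)

/-- A minimal topological dynamical system: a nonempty compact metric space together with a
continuous map all of whose forward orbits are dense. -/
structure MinSystem : Type 1 where
  X : Type
  [met : MetricSpace X]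
  [cpt : CompactSpace X]
  [nem : Nonempty X]
  T : X → X
  cont : Continuous T
  minimal : MinimalMap T

attribute [instance] MinSystem.met MinSystem.cpt MinSystem.nem

/-- `R(x,U)`: the set of (positive) return times of `x` to `U`. -/
def retTimes {X : Type} (T : X → X) (x : X) (U : Set X) : Set ℕ+ :=
  {n : ℕ+ | T^[(n : ℕ)] x ∈ U}

/-- Dynamically syndetic sets. -/
def DynSyndetic (A : Set ℕ+) : Prop :=
  ∃ (S : MinSystem) (x : S.X) (U : Set S.X),
    IsOpen U ∧ U.Nonempty ∧ retTimes S.T x U ⊆ A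

/-- Dynamically central syndetic sets. -/
def DynCentralSyndetic (A : Set ℕ+) : Prop :=
  ∃ (S : MinSystem) (x : S.X) (U : Set S.X),
    IsOpen U ∧ x ∈ U ∧ retTimes S.T x U ⊆ A

/-- Dynamically thick sets: `{T^n x | n ∈ A}` is dense for every minimal system and point. -/
def DynThick (A : Set ℕ+) : Prop :=
  ∀ (S : MinSystem) (x : S.X), Dense ((fun n : ℕ+ => S.T^[(n : ℕ)] x) '' A)

/-- Sets of (minimal topological) pointwise recurrence. -/
def PointwiseRecurrent (A : Set ℕ+) : Prop :=
  ∀ (S : MinSystem) (x : S.X) (U : Set S.X), IsOpen U → x ∈ U →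
    ∃ a ∈ A, S.T^[(a : ℕ)] x ∈ U

/-- A family: an upward-closed collection of subsets of the positive integers. -/
def UpwardClosed (F : Set (Set ℕ+)) : Prop :=
  ∀ ⦃A B : Set ℕ+⦄, A ∈ F → A ⊆ B → B ∈ F

/-- A filter (in the combinatorial sense): an upward-closed collection closed under
finite intersections. -/
def IsFilterFamily (F : Set (Set ℕ+)) : Prop :=
  UpwardClosed F ∧ ∀ ⦃A B : Set ℕ+⦄, A ∈ F → B ∈ F → A ∩ B ∈ F

/-- A family all of whose members are syndetic. -/
def SyndeticFamily (F : Set (Set ℕ+)) : Prop := ∀ A ∈ F, Syndetic A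

/-- `A − 𝔉 := {n | A − n ∈ 𝔉}`. -/
def famShift (A : Set ℕ+) (F : Set (Set ℕ+)) : Set ℕ+ := {n : ℕ+ | shiftN A n ∈ F}

/-- `𝔉 + 𝔊 := {A | A − 𝔊 ∈ 𝔉}`. -/
def famSum (F G : Set (Set ℕ+)) : Set (Set ℕ+) := {A : Set ℕ+ | famShift A G ∈ F}

/-- A family is idempotent if `𝔉 ⊆ 𝔉 + 𝔉`. -/
def IdempotentFamily (F : Set (Set ℕ+)) : Prop := F ⊆ famSum F F

/-- A proper family: nonempty and not containing the empty set. -/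
def ProperFamily (F : Set (Set ℕ+)) : Prop := F.Nonempty ∧ ∅ ∉ F
lemma PNat.iterate_add_apply {X : Type} (T : X → X) (m n : ℕ+) (x : X) :
    T^[((m + n : ℕ+) : ℕ)] x = T^[(n : ℕ)] (T^[(m : ℕ)] x) := by
  rw [PNat.add_coe, add_comm, Function.iterate_add_apply]

/-- If a point visits a closed set `V` along shifts by `F` thickly often, then the preimages of `V`
under the iterates with exponents in `F` cover the minimal system. -/
lemma exists_iterate_mem_of_thick (S : MinSystem) (x : S.X) {V : Set S.X} (hV : IsClosed V)
    (F : Finset ℕ+) (h : Thick (⋃ f ∈ F, shiftN (retTimes S.T x V) f)) (z : S.X) :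
    ∃ f ∈ F, S.T^[(f : ℕ)] z ∈ V := by
  have hcont (n : ℕ) : Continuous S.T^[n] := S.cont.iterate n
  set W : Set S.X := ⋃ f ∈ F, S.T^[(f : ℕ)] ⁻¹' V with hW
  have hWc : IsClosed W := F.finite_toSet.isClosed_biUnion fun f _ => hV.preimage (hcont f)
  let Z : ℕ → Set S.X := fun l => ⋂ m ∈ {m : ℕ+ | (m : ℕ) ≤ l}, S.T^[(m : ℕ)] ⁻¹' W
  have hZc (l : ℕ) : IsClosed (Z l) :=
    isClosed_biInter fun m _ => hWc.preimage (hcont m)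
  have hZn (l : ℕ) : (Z l).Nonempty := by
    obtain ⟨n, hn⟩ := h (Finset.Icc 1 l.succPNat)
    refine ⟨S.T^[(n : ℕ)] x, ?_⟩
    simp only [Z, mem_iInter, mem_preimage]
    intro m hm
    have h1 : m ∈ Finset.Icc 1 l.succPNat := by
      rw [Finset.mem_Icc]
      refine ⟨one_le, ?_⟩
      rw [← PNat.coe_le_coe, Nat.succPNat_coe]
      exact Nat.le_succ_of_le hm
    have h2 := hn m h1
    simp only [mem_iUnion] at h2
    obtain ⟨f, hf, h3⟩ := h2
    simp only [hW, mem_iUnion]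
    refine ⟨f, hf, ?_⟩
    have h4 : S.T^[((m + n + f : ℕ+) : ℕ)] x ∈ V := h3
    rwa [PNat.iterate_add_apply, add_comm m n, PNat.iterate_add_apply] at h4
  obtain ⟨y, hy⟩ := IsCompact.nonempty_iInter_of_sequence_nonempty_isCompact_isClosed Z
    (fun l => biInter_subset_biInter_left fun m hm => Nat.le_succ_of_le hm)
    hZn (hZc 0).isCompact hZc
  have hyW : (range fun n : ℕ+ => S.T^[(n : ℕ)] y) ⊆ W := by
    rintro _ ⟨n, rfl⟩
    have := mem_iInter.1 hy n
    simp only [Z, mem_iInter, mem_preimage] at this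
    exact this n (le_refl (n : ℕ))
  have hz : z ∈ W := closure_minimal hyW hWc (S.minimal y z)
  simpa [hW] using hz

lemma piecewiseSyndetic_retTimes (S : MinSystem) (x : S.X) {U : Set S.X} (hU : IsOpen U)
    (hne : U.Nonempty) : PiecewiseSyndetic (retTimes S.T x U) := by
  obtain ⟨t, ht⟩ := isCompact_univ.elim_finite_subcover (fun n : ℕ+ => S.T^[(n : ℕ)] ⁻¹' U)
    (fun n => hU.preimage (S.cont.iterate n)) (by
      intro z _
      obtain ⟨_, hz, n, rfl⟩ := (S.minimal z).inter_open_nonempty U hU hne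
      exact mem_iUnion.2 ⟨n, hz⟩)
  refine ⟨t.sup id + 1, fun F => ⟨1, fun f _ => Or.inr ?_⟩⟩
  have h := ht (mem_univ (S.T^[((f + 1 : ℕ+) : ℕ)] x))
  simp only [mem_iUnion] at h ⊢
  obtain ⟨k, hk, h⟩ := h
  refine ⟨k, (Finset.le_sup (f := id) hk).trans (PNat.lt_add_right _ _).le, ?_⟩
  change S.T^[_] x ∈ U
  rwa [PNat.iterate_add_apply]

lemma dynThick_iff (A : Set ℕ+) : DynThick A ↔ ∀ (S : MinSystem) (x : S.X) (U : Set S.X),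
    IsOpen U → U.Nonempty → ∃ a ∈ A, S.T^[(a : ℕ)] x ∈ U := by
  refine forall_congr' fun S => forall_congr' fun x => ?_
  rw [dense_iff_inter_open]
  refine forall_congr' fun U => forall_congr' fun _ => forall_congr' fun _ => ?_
  constructor
  · rintro ⟨_, hz, a, ha, rfl⟩
    exact ⟨a, ha, hz⟩
  · rintro ⟨a, ha, hz⟩
    exact ⟨_, hz, a, ha, rfl⟩

lemma dynThick_of_superset {A : Set ℕ+}
    (h : ∀ B : Set ℕ+, A ⊆ B → B ≠ Set.univ →
      ∃ F : Finset ℕ+, (F : Set ℕ+) ⊆ Bᶜ ∧ Thick (⋃ f ∈ F, shiftN B f)) : DynThick A := by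
  rw [dynThick_iff]
  intro S x U hU hne
  by_contra! hA
  obtain ⟨F, hF, hT⟩ := h (retTimes S.T x Uᶜ) (fun a ha => hA a ha) (by
    obtain ⟨_, hz, n, rfl⟩ := (S.minimal x).inter_open_nonempty U hU hne
    intro h
    exact (h.symm ▸ mem_univ n : n ∈ retTimes S.T x Uᶜ) hz)
  obtain ⟨f, hf, hfx⟩ := exists_iterate_mem_of_thick S x hU.isClosed_compl F hT x
  exact hF hf hfx

lemma dynThick_of_piecewiseSyndetic {A : Set ℕ+}
    (h : ∀ S : Set ℕ+, PiecewiseSyndetic S →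
      ∃ F : Finset ℕ+, (F : Set ℕ+) ⊆ A ∧ Thick (⋃ f ∈ F, shiftN S f)) : DynThick A := by
  rw [dynThick_iff]
  rintro S x U hU ⟨u, hu⟩
  obtain ⟨V, hV, hVc, hVU⟩ := exists_mem_nhds_isClosed_subset (hU.mem_nhds hu)
  obtain ⟨F, hF, hT⟩ := h _ (piecewiseSyndetic_retTimes S x isOpen_interior
    ⟨u, mem_interior_iff_mem_nhds.2 hV⟩)
  have hT' : Thick (⋃ f ∈ F, shiftN (retTimes S.T x V) f) := by
    intro W
    obtain ⟨n, hn⟩ := hT W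
    refine ⟨n, fun w hw => ?_⟩
    have h := hn w hw
    simp only [mem_iUnion] at h ⊢
    obtain ⟨f, hf, h⟩ := h
    exact ⟨f, hf, interior_subset (s := V) h⟩
  obtain ⟨f, hf, hfx⟩ := exists_iterate_mem_of_thick S x hVc F hT' x
  exact ⟨f, hF hf, hVU hfx⟩

/-- Every nonempty closed forward-invariant set in a compact space contains a minimal one. -/
lemma exists_minimal_invariant {X : Type} [TopologicalSpace X] [CompactSpace X] {T : X → X}
    (hT : Continuous T) {Y : Set X} (hYc : IsClosed Y) (hYn : Y.Nonempty) (hYT : MapsTo T Y Y) :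
    ∃ M ⊆ Y, IsClosed M ∧ M.Nonempty ∧ MapsTo T M M ∧
      ∀ x ∈ M, M ⊆ closure (range fun n : ℕ+ => T^[(n : ℕ)] x) := by
  obtain ⟨M, hMY, hM⟩ := zorn_superset_nonempty
    {M : Set X | IsClosed M ∧ M.Nonempty ∧ MapsTo T M M} (by
      intro c hc hchain hcn
      have := hcn.to_subtype
      have hdir : DirectedOn (fun s t : Set X => s ⊇ t) c := by
        intro s hs t ht
        rcases hchain.total hs ht with h | h
        · exact ⟨s, hs, subset_rfl, h⟩
        · exact ⟨t, ht, h, subset_rfl⟩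
      refine ⟨⋂₀ c, ⟨isClosed_sInter fun s hs => (hc hs).1, ?_, ?_⟩,
        fun s hs => sInter_subset_of_mem hs⟩
      · exact IsCompact.nonempty_sInter_of_directed_nonempty_isCompact_isClosed
          hdir (fun s hs => (hc hs).2.1)
          (fun s hs => (hc hs).1.isCompact) (fun s hs => (hc hs).1)
      · exact fun x hx s hs => (hc hs).2.2 (hx s hs)) Y ⟨hYc, hYn, hYT⟩
  obtain ⟨hMc, hMn, hMT⟩ := hM.prop
  refine ⟨M, hMY, hMc, hMn, hMT, fun x hx => ?_⟩
  refine hM.le_of_le ⟨isClosed_closure, ⟨T^[1] x, subset_closure ⟨1, rfl⟩⟩, ?_⟩ ?_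
  · refine MapsTo.closure ?_ hT
    rintro _ ⟨n, rfl⟩
    exact ⟨n + 1, Function.iterate_succ_apply' _ _ _⟩
  · refine closure_minimal ?_ hMc
    rintro _ ⟨n, rfl⟩
    exact hMT.iterate n hx

/-- The left shift on binary sequences. -/
def boolShift (x : ℕ → Bool) : ℕ → Bool := fun n => x (n + 1)

lemma continuous_boolShift : Continuous boolShift :=
  continuous_pi fun n => continuous_apply (n + 1)

lemma boolShift_iterate (k : ℕ) (x : ℕ → Bool) (n : ℕ) : boolShift^[k] x n = x (n + k) := by
  induction k generalizing x with
  | zero => rfl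
  | succ k ih => rw [Function.iterate_succ_apply, ih]; rfl

lemma isOpen_setOf_apply_eq_true (n : ℕ) : IsOpen {x : ℕ → Bool | x n = true} :=
  (isOpen_discrete {true}).preimage (f := fun x : ℕ → Bool => x n) (continuous_apply n)

lemma isClosed_of_finite_dependence (l : ℕ) (P : (Fin l → Bool) → Prop) :
    IsClosed {y : ℕ → Bool | P fun i => y i} :=
  (isClosed_discrete {z | P z}).preimage
    (f := fun (y : ℕ → Bool) (i : Fin l) => y i) (by fun_prop)

/-- A piecewise syndetic set is represented by a minimal subshift whose words all occur in it. -/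
lemma PiecewiseSyndetic.exists_subshift {S : Set ℕ+} (hS : PiecewiseSyndetic S) :
    ∃ M : Set (ℕ → Bool), IsClosed M ∧ M.Nonempty ∧ MapsTo boolShift M M ∧
      (∀ x ∈ M, M ⊆ closure (range fun n : ℕ+ => boolShift^[(n : ℕ)] x)) ∧
      (∃ x ∈ M, x 0 = true) ∧
      ∀ x ∈ M, ∀ l : ℕ, ∃ n : ℕ+, ∀ i : ℕ+, (i : ℕ) < l → x i = true → i + n ∈ S := by
  obtain ⟨N, hN⟩ := hS
  let Z : ℕ → Set (ℕ → Bool) := fun l =>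
    {y | (∃ n : ℕ+, ∀ i : ℕ+, (i : ℕ) < l → y i = true → i + n ∈ S) ∧
      ∀ m : ℕ, m + N < l → ∃ k ≤ (N : ℕ), y (m + k) = true}
  have hZc (l : ℕ) : IsClosed (Z l) := by
    convert isClosed_of_finite_dependence l (fun z =>
      (∃ n : ℕ+, ∀ i : ℕ+, ∀ h : (i : ℕ) < l, z ⟨i, h⟩ = true → i + n ∈ S) ∧
      ∀ m : ℕ, ∀ h : m + N < l, ∃ k, ∃ h' : k ≤ (N : ℕ), z ⟨m + k, by omega⟩ = true) using 1
    ext y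
    simp [Z]
  have hZm (l : ℕ) : Z (l + 1) ⊆ Z l := by
    rintro y ⟨⟨n, hn⟩, h⟩
    exact ⟨⟨n, fun i hi => hn i (by omega)⟩, fun m hm => h m (by omega)⟩
  have hZn (l : ℕ) : (Z l).Nonempty := by
    classical
    obtain ⟨n, hn⟩ := hN (Finset.Icc 1 (l + 1).succPNat)
    refine ⟨fun i => decide ((⟨i + 1 + n, by omega⟩ : ℕ+) ∈ S), ⟨1 + n, ?_⟩, ?_⟩
    · intro i _ hi
      have h := of_decide_eq_true hi
      convert h using 1
      refine iff_of_eq (congrArg (· ∈ S) (PNat.eq ?_))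
      simp [PNat.add_coe, add_assoc]
    · intro m hm
      have h := hn m.succPNat (by
        rw [Finset.mem_Icc]
        refine ⟨one_le, ?_⟩
        rw [← PNat.coe_le_coe, Nat.succPNat_coe, Nat.succPNat_coe]
        omega)
      rcases h with h | h
      · refine ⟨0, Nat.zero_le _, decide_eq_true ?_⟩
        exact h
      · simp only [mem_iUnion] at h
        obtain ⟨k, hk, h⟩ := h
        refine ⟨k, hk, decide_eq_true ?_⟩
        have h' : m.succPNat + n + k ∈ S := h
        convert h' using 1
        refine iff_of_eq (congrArg (· ∈ S) (PNat.eq ?_))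
        simp [PNat.add_coe]
        omega
  have hYc : IsClosed (⋂ l, Z l) := isClosed_iInter hZc
  have hYn : (⋂ l, Z l).Nonempty :=
    IsCompact.nonempty_iInter_of_sequence_nonempty_isCompact_isClosed Z hZm hZn
      (hZc 0).isCompact hZc
  have hYT : MapsTo boolShift (⋂ l, Z l) (⋂ l, Z l) := by
    intro y hy
    rw [mem_iInter] at hy ⊢
    intro l
    obtain ⟨⟨n, hn⟩, h⟩ := hy (l + 1)
    refine ⟨⟨1 + n, fun i hi h1 => ?_⟩, fun m hm => ?_⟩
    · rw [← add_assoc]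
      exact hn (i + 1) (by rw [PNat.add_coe, PNat.one_coe]; omega) h1
    · obtain ⟨k, hk, h1⟩ := h (m + 1) (by omega)
      refine ⟨k, hk, ?_⟩
      change y (m + k + 1) = true
      rwa [add_right_comm]
  obtain ⟨M, hMY, hMc, ⟨x, hx⟩, hMT, hM⟩ :=
    exists_minimal_invariant continuous_boolShift hYc hYn hYT
  refine ⟨M, hMc, ⟨x, hx⟩, hMT, hM, ?_, fun x hx l => (mem_iInter.1 (hMY hx) l).1⟩
  obtain ⟨k, _, h⟩ := (mem_iInter.1 (hMY hx) (N + 1)).2 0 (by omega)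
  refine ⟨boolShift^[k] x, hMT.iterate k hx, ?_⟩
  rwa [boolShift_iterate]

lemma DynThick.exists_thick_shift {A : Set ℕ+} (hA : DynThick A) {S : Set ℕ+}
    (hS : PiecewiseSyndetic S) :
    ∃ F : Finset ℕ+, (F : Set ℕ+) ⊆ A ∧ Thick (⋃ f ∈ F, shiftN S f) := by
  classical
  obtain ⟨M, hMc, ⟨y, hy⟩, hMT, hM, ⟨z, hz, hz0⟩, hMS⟩ := hS.exists_subshift
  let : MetricSpace M := TopologicalSpace.metrizableSpaceMetric M
  have : CompactSpace M := isCompact_iff_compactSpace.1 hMc.isCompact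
  have : Nonempty M := ⟨⟨y, hy⟩⟩
  have hcoe (n : ℕ) (x : M) : ((hMT.restrict boolShift M M)^[n] x : ℕ → Bool) =
      boolShift^[n] x := by
    rw [hMT.iterate_restrict]; rfl
  let 𝒮 : MinSystem :=
    { X := M
      T := hMT.restrict boolShift M M
      cont := continuous_boolShift.restrict hMT
      minimal := by
        intro x w
        rw [closure_subtype, ← range_comp]
        have := hM x x.2 w.2
        convert this using 3
        ext n
        simp [hcoe] }
  have hcover : M ⊆ ⋃ a ∈ A, {x : ℕ → Bool | x (a : ℕ+) = true} := by
    intro x hx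
    obtain ⟨a, ha, h⟩ := (dynThick_iff A).1 hA 𝒮 ⟨x, hx⟩ {x : M | (x : ℕ → Bool) 0 = true}
      ((isOpen_setOf_apply_eq_true 0).preimage continuous_subtype_val) ⟨⟨z, hz⟩, hz0⟩
    have h' : ((hMT.restrict boolShift M M)^[(a : ℕ)] ⟨x, hx⟩ : ℕ → Bool) 0 = true := h
    rw [hcoe, boolShift_iterate, zero_add] at h'
    exact mem_biUnion ha h'
  obtain ⟨b, hbA, hbf, hb⟩ := hMc.isCompact.elim_finite_subcover_image
    (fun (a : ℕ+) _ => isOpen_setOf_apply_eq_true (a : ℕ)) hcover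
  refine ⟨hbf.toFinset, by simpa using hbA, fun W => ?_⟩
  obtain ⟨n, hn⟩ := hMS y hy ((W.sup fun w => (w : ℕ)) + (hbf.toFinset.sup fun f => (f : ℕ)) + 1)
  refine ⟨n, fun w hw => ?_⟩
  have h := hb (hMT.iterate w hy)
  simp only [mem_iUnion] at h ⊢
  obtain ⟨f, hf, h⟩ := h
  have hf' : f ∈ hbf.toFinset := hbf.mem_toFinset.2 hf
  refine ⟨f, hf', ?_⟩
  change w + n + f ∈ S
  rw [add_right_comm]
  refine hn (w + f) ?_ ?_
  · have h1 := Finset.le_sup (f := fun w : ℕ+ => (w : ℕ)) hw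
    have h2 := Finset.le_sup (f := fun w : ℕ+ => (w : ℕ)) hf'
    rw [PNat.add_coe]
    omega
  · have h' : boolShift^[(w : ℕ)] y f = true := h
    rwa [boolShift_iterate, add_comm] at h'

/-- Near each point of `[a, b)` there is a window `[e, e + L) ⊆ [a, b)` in which the differences
of elements of `S` with `e` lie in `C`. -/
def StartsNear (C S : Set ℕ) (a b L M : ℕ) : Prop :=
  ∀ n, a ≤ n → n < b → ∃ e, a ≤ e ∧ e + L ≤ b ∧ n ≤ e + M ∧ e ≤ n + M ∧
    ∀ f < L, e + f ∈ S → f ∈ C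

/-- `S` is a relatively dense subset of `C ∩ [a, b)` satisfying all the conditions `StartsNear`
with parameters in `Q`. -/
structure Fills (C : Set ℕ) (K : ℕ) (Q : Set (ℕ × ℕ)) (a b : ℕ) (S : Set ℕ) : Prop where
  subset : S ⊆ C
  subset_Ico : S ⊆ Ico a b
  dense : ∀ n, a ≤ n → n < b → ∃ s ∈ S, n ≤ s + K ∧ s ≤ n + K
  starts : ∀ p ∈ Q, StartsNear C S a b p.1 p.2

lemma Fills.append {C : Set ℕ} {K : ℕ} {Q : Set (ℕ × ℕ)} {a b c : ℕ} {S S' : Set ℕ}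
    (hab : a ≤ b) (hbc : b ≤ c) (h : Fills C K Q a b S) (h' : Fills C K Q b c S') :
    Fills C K Q a c (S ∪ S') where
  subset := union_subset h.subset h'.subset
  subset_Ico := union_subset (h.subset_Ico.trans (Ico_subset_Ico_right hbc))
    (h'.subset_Ico.trans (Ico_subset_Ico_left hab))
  dense n hn hnc := by
    rcases lt_or_ge n b with hnb | hnb
    · obtain ⟨s, hs, h1⟩ := h.dense n hn hnb
      exact ⟨s, Or.inl hs, h1⟩
    · obtain ⟨s, hs, h1⟩ := h'.dense n hnb hnc
      exact ⟨s, Or.inr hs, h1⟩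
  starts p hp n hn hnc := by
    rcases lt_or_ge n b with hnb | hnb
    · obtain ⟨e, h1, h2, h3, h4, h5⟩ := h.starts p hp n hn hnb
      refine ⟨e, h1, by omega, h3, h4, fun f hf hef => ?_⟩
      rcases hef with hef | hef
      · exact h5 f hf hef
      · have := (h'.subset_Ico hef).1
        omega
    · obtain ⟨e, h1, h2, h3, h4, h5⟩ := h'.starts p hp n hnb hnc
      refine ⟨e, by omega, h2, h3, h4, fun f hf hef => ?_⟩
      rcases hef with hef | hef
      · have := (h.subset_Ico hef).2
        omega
      · exact h5 f hf hef

lemma Fills.translate {C : Set ℕ} {K : ℕ} {Q : Set (ℕ × ℕ)} {L : ℕ} {S : Set ℕ}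
    (h : Fills C K Q 0 L S) {e : ℕ} (he : ∀ f ∈ S, e + f ∈ C) :
    Fills C K Q e (e + L) ((e + ·) '' S) where
  subset := by
    rintro _ ⟨f, hf, rfl⟩
    exact he f hf
  subset_Ico := by
    rintro _ ⟨f, hf, rfl⟩
    have := (h.subset_Ico hf).2
    exact ⟨Nat.le_add_right _ _, Nat.add_lt_add_left this e⟩
  dense n hn hnL := by
    obtain ⟨s, hs, h1, h2⟩ := h.dense (n - e) (Nat.zero_le _) (by omega)
    exact ⟨e + s, mem_image_of_mem _ hs, by omega, by omega⟩
  starts p hp n hn hnL := by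
    obtain ⟨i, h1, h2, h3, h4, h5⟩ := h.starts p hp (n - e) (Nat.zero_le _) (by omega)
    refine ⟨e + i, by omega, by omega, by omega, by omega, ?_⟩
    rintro f hf ⟨s, hs, hsf⟩
    have : s = i + f := by simp only at hsf; omega
    exact h5 f hf (this ▸ hs)

/-- The finite intersections of the sets `C - f`, `f ∈ C`, have bounded gaps. -/
def FinitelySyndetic (C : Set ℕ) : Prop :=
  ∀ F : Finset ℕ, (F : Set ℕ) ⊆ C → ∃ g, ∀ n, ∃ e, n ≤ e ∧ e < n + g ∧ ∀ f ∈ F, e + f ∈ C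

/-- Every interval of length at least `D` can be filled. -/
def Fillable (C : Set ℕ) (K : ℕ) (Q : Set (ℕ × ℕ)) (D : ℕ) : Prop :=
  ∀ a b, a + D ≤ b → ∃ S, Fills C K Q a b S

lemma FinitelySyndetic.exists_fillable_empty {C : Set ℕ} (hC : FinitelySyndetic C)
    (hne : C.Nonempty) : ∃ K, Fillable C K ∅ K := by
  obtain ⟨c, hc⟩ := hne
  obtain ⟨g, hg⟩ := hC {c} (by simpa using hc)
  refine ⟨g + c, fun a b hab => ⟨C ∩ Ico a b, inter_subset_left, inter_subset_right, ?_, by simp⟩⟩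
  intro n hn hnb
  obtain ⟨e, h1, h2, h3⟩ := hg (min n (b - (g + c)))
  exact ⟨e + c, ⟨h3 c (by simp), by omega, by omega⟩, by omega, by omega⟩

lemma FinitelySyndetic.exists_fillable_insert {C : Set ℕ} (hC : FinitelySyndetic C) {K D : ℕ}
    {Q : Set (ℕ × ℕ)} (h : Fillable C K Q D) (l : ℕ) :
    ∃ L M D', l ≤ L ∧ Fillable C K (insert (L, M) Q) D' := by
  classical
  set L := max D l
  obtain ⟨w, hw⟩ := h 0 L (by omega)
  obtain ⟨g, hg⟩ := hC ((Finset.range L).filter (· ∈ w)) (by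
    intro f hf
    exact hw.subset (by simpa using (Finset.mem_filter.1 hf).2))
  set D' := D + g + L + D with hD'
  have hgpos : 0 < g := by
    obtain ⟨e, h1, h2, -⟩ := hg 0
    omega
  have hpiece (a b : ℕ) (hab : a + D' ≤ b) (hab' : b < a + 2 * D') :
      ∃ S, Fills C K (insert (L, 2 * D') Q) a b S := by
    obtain ⟨e, h1, h2, h3⟩ := hg (a + D)
    obtain ⟨S₁, hS₁⟩ := h a e h1
    obtain ⟨S₃, hS₃⟩ := h (e + L) b (by omega)
    have hS₂ : Fills C K Q e (e + L) ((e + ·) '' w) := hw.translate fun f hf =>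
      h3 f (Finset.mem_filter.2 ⟨Finset.mem_range.2 (hw.subset_Ico hf).2, hf⟩)
    have hS := (hS₁.append (by omega) (by omega) hS₂).append (by omega) (by omega) hS₃
    refine ⟨_, hS.subset, hS.subset_Ico, hS.dense, ?_⟩
    rintro p (rfl | hp)
    · intro n hn hnb
      refine ⟨e, by omega, by omega, by simp only; omega, by simp only; omega, ?_⟩
      rintro f hf ((hef | ⟨s, hs, hsf⟩) | hef)
      · have := (hS₁.subset_Ico hef).2
        omega
      · have : s = f := by simpa using hsf
        exact this ▸ hw.subset hs
      · have := (hS₃.subset_Ico hef).1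
        simp only at hf
        omega
    · exact hS.starts p hp
  refine ⟨L, 2 * D', D', le_max_right _ _, fun a b hab => ?_⟩
  obtain ⟨d, hd⟩ : ∃ d, d = b - a := ⟨_, rfl⟩
  induction d using Nat.strong_induction_on generalizing a with
  | _ d ih =>
    rcases lt_or_ge b (a + 2 * D') with hlt | hge
    · exact hpiece a b hab hlt
    · obtain ⟨S, hS⟩ := hpiece a (a + D') le_rfl (by omega)
      obtain ⟨S', hS'⟩ := ih (b - (a + D')) (by omega) (a + D') (by omega) rfl
      exact ⟨_, hS.append (by omega) (by omega) hS'⟩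

lemma FinitelySyndetic.exists_fillable_seq {C : Set ℕ} (hC : FinitelySyndetic C)
    (hne : C.Nonempty) : ∃ (K : ℕ) (Q : ℕ → Set (ℕ × ℕ)) (D : ℕ → ℕ),
      (∀ k, Fillable C K (Q k) (D k)) ∧ Monotone Q ∧ ∀ l, ∃ p ∈ Q (l + 1), l ≤ p.1 := by
  obtain ⟨K, hK⟩ := hC.exists_fillable_empty hne
  have hstep (l : ℕ) (x : {x : Set (ℕ × ℕ) × ℕ // Fillable C K x.1 x.2}) :
      ∃ y : {x : Set (ℕ × ℕ) × ℕ // Fillable C K x.1 x.2},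
        x.1.1 ⊆ y.1.1 ∧ ∃ p ∈ y.1.1, l ≤ p.1 := by
    obtain ⟨L, M, D', hL, h⟩ := hC.exists_fillable_insert x.2 l
    exact ⟨⟨(_, D'), h⟩, subset_insert _ _, (L, M), mem_insert _ _, hL⟩
  choose φ hφ hφl using hstep
  let x : ℕ → {x : Set (ℕ × ℕ) × ℕ // Fillable C K x.1 x.2} := fun n =>
    Nat.rec ⟨(∅, K), hK⟩ φ n
  exact ⟨K, fun n => (x n).1.1, fun n => (x n).1.2, fun n => (x n).2,
    monotone_nat_of_le_succ fun n => hφ n (x n), fun l => hφl l (x l)⟩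

/-- There is a syndetic set `S` such that, for each `l`, the set of `n` for which all differences
`s - n < l` with `s ∈ S` lie in `C` is syndetic. -/
lemma FinitelySyndetic.exists_syndetic {C : Set ℕ} (hC : FinitelySyndetic C)
    (hne : C.Nonempty) : ∃ S : Set ℕ, (∃ M, ∀ n, ∃ s ∈ S, n ≤ s ∧ s ≤ n + M) ∧
      ∀ l, ∃ M, ∀ n, ∃ e, n ≤ e ∧ e ≤ n + M ∧ ∀ f < l, e + f ∈ S → f ∈ C := by
  obtain ⟨K, Q, D, hD, hQ, hl⟩ := hC.exists_fillable_seq hne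
  let b : ℕ → ℕ := fun j => ∑ i ∈ Finset.range j, (D i + 1)
  have hb (j : ℕ) : b (j + 1) = b j + (D j + 1) := Finset.sum_range_succ _ _
  have hbm : StrictMono b := strictMono_nat_of_lt_succ fun j => by have := hb j; omega
  choose S hS using fun j => hD j (b j) (b (j + 1)) (by have := hb j; omega)
  have hloc (n : ℕ) : ∃ j, b j ≤ n ∧ n < b (j + 1) := by
    have hex : ∃ j, n < b (j + 1) := ⟨n, (Nat.lt_succ_self n).trans_le (hbm.id_le (n + 1))⟩
    classical
    refine ⟨Nat.find hex, ?_, Nat.find_spec hex⟩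
    rcases h : Nat.find hex with _ | j
    · simp [b]
    · exact not_lt.1 (Nat.find_min hex (m := j) (by omega))
  have hmem {j n : ℕ} (h1 : b j ≤ n) (h2 : n < b (j + 1)) (h : n ∈ ⋃ i, S i) : n ∈ S j := by
    obtain ⟨i, hi⟩ := mem_iUnion.1 h
    obtain ⟨h3, h4⟩ := (hS i).subset_Ico hi
    have h5 := hbm.lt_iff_lt.1 (h1.trans_lt h4)
    have h6 := hbm.lt_iff_lt.1 (h3.trans_lt h2)
    have : i = j := by omega
    exact this ▸ hi
  refine ⟨⋃ j, S j, ⟨2 * K, fun n => ?_⟩, fun l => ?_⟩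
  · obtain ⟨j, h1, h2⟩ := hloc (n + K)
    obtain ⟨s, hs, h3, h4⟩ := (hS j).dense _ h1 h2
    exact ⟨s, mem_iUnion.2 ⟨j, hs⟩, by omega, by omega⟩
  · obtain ⟨⟨L, M⟩, hp, hL⟩ := hl l
    refine ⟨b (l + 1) + 2 * M, fun n => ?_⟩
    obtain ⟨j, h1, h2⟩ := hloc (n + b (l + 1) + M)
    have hj : l + 1 ≤ j :=
      Nat.lt_succ_iff.1 (hbm.lt_iff_lt.1 (show b (l + 1) < b (j + 1) by omega))
    obtain ⟨e, h3, h4, h5, h6, h7⟩ := (hS j).starts _ (hQ hj hp) _ h1 h2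
    simp only at h3 h4 h5 h6 h7 hL
    exact ⟨e, by omega, by omega, fun f hf hef =>
      h7 f (by omega) (hmem (by omega) (by omega) hef)⟩

lemma exists_thick_of_superset {A : Set ℕ+}
    (h : ∀ S : Set ℕ+, PiecewiseSyndetic S →
      ∃ F : Finset ℕ+, (F : Set ℕ+) ⊆ A ∧ Thick (⋃ f ∈ F, shiftN S f))
    {B : Set ℕ+} (hAB : A ⊆ B) (hB : B ≠ Set.univ) :
    ∃ F : Finset ℕ+, (F : Set ℕ+) ⊆ Bᶜ ∧ Thick (⋃ f ∈ F, shiftN B f) := by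
  classical
  by_contra! hF
  let C : Set ℕ := (fun n : ℕ+ => (n : ℕ)) '' Bᶜ
  have hC : FinitelySyndetic C := by
    intro F hFC
    obtain ⟨F, hFB, rfl⟩ := Finset.subset_set_image_iff.1 hFC
    have hT := hF F hFB
    simp only [Thick, not_forall, not_exists] at hT
    obtain ⟨W, hW⟩ := hT
    refine ⟨(W.sup fun w => (w : ℕ)) + 2, fun n => ?_⟩
    obtain ⟨w, hw, hwn⟩ := hW n.succPNat
    have h1 : (w : ℕ) ≤ W.sup fun w => (w : ℕ) := Finset.le_sup (f := fun w : ℕ+ => (w : ℕ)) hw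
    refine ⟨((w + n.succPNat : ℕ+) : ℕ), ?_, ?_, ?_⟩
    · rw [PNat.add_coe, Nat.succPNat_coe]; omega
    · rw [PNat.add_coe, Nat.succPNat_coe]; omega
    · intro f hf
      obtain ⟨f, hfF, rfl⟩ := Finset.mem_image.1 hf
      refine ⟨w + n.succPNat + f, fun hmem => hwn ?_, rfl⟩
      exact mem_biUnion (show f ∈ (F : Set ℕ+) from hfF) hmem
  obtain ⟨S, ⟨M, hM⟩, hS⟩ := hC.exists_syndetic ((nonempty_compl.2 hB).image _)
  obtain ⟨F, hFA, hT⟩ := h {n | (n : ℕ) ∈ S} (by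
    refine ⟨M.succPNat, fun F => ⟨1, fun f _ => Or.inr ?_⟩⟩
    obtain ⟨s, hs, h1, h2⟩ := hM ((f + 1 : ℕ+) + 1)
    refine mem_biUnion (x := ⟨s - (f + 1 : ℕ+), by omega⟩) ?_ ?_
    · change s - ((f + 1 : ℕ+) : ℕ) ≤ M + 1
      omega
    · change ((f + 1 : ℕ+) : ℕ) + (s - (f + 1 : ℕ+)) ∈ S
      rwa [Nat.add_sub_cancel' (by omega)])
  obtain ⟨M', hM'⟩ := hS ((F.sup fun f => (f : ℕ)) + 1)
  obtain ⟨n, hn⟩ := hT (Finset.Icc 1 M'.succPNat)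
  obtain ⟨e, h1, h2, h3⟩ := hM' (n + 1)
  let w : ℕ+ := ⟨e - n, by omega⟩
  have hw : w ∈ Finset.Icc 1 M'.succPNat := by
    refine Finset.mem_Icc.2 ⟨one_le, ?_⟩
    change e - (n : ℕ) ≤ M' + 1
    omega
  have h4 := hn w hw
  simp only [mem_iUnion] at h4
  obtain ⟨f, hf, h4⟩ := h4
  have h5 : e - (n : ℕ) + n + f ∈ S := h4
  rw [Nat.sub_add_cancel (by omega)] at h5
  obtain ⟨c, hc, hcf⟩ := h3 f
    (Nat.lt_succ_of_le (Finset.le_sup (f := fun f : ℕ+ => (f : ℕ)) hf)) h5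
  exact hc (PNat.eq hcf ▸ hAB (hFA hf))

/-- **Theorem (dynamically thick characterizations).** For `A ⊆ ℕ` the following are
equivalent:
(1) `A` is dynamically thick;
(2) for every `B` with `A ⊆ B ⊊ ℕ` there is a finite `F ⊆ ℕ ∖ B` such that `B − F` is thick;
(3) for every piecewise syndetic `S ⊆ ℕ` there is a finite `F ⊆ A` such that `S − F` is
    thick. -/
theorem dynThick_tfae (A : Set ℕ+) :
    (DynThick A ↔
      ∀ B : Set ℕ+, A ⊆ B → B ≠ Set.univ →
        ∃ F : Finset ℕ+, (F : Set ℕ+) ⊆ Bᶜ ∧ Thick (⋃ f ∈ F, shiftN B f)) ∧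
    (DynThick A ↔
      ∀ S : Set ℕ+, PiecewiseSyndetic S →
        ∃ F : Finset ℕ+, (F : Set ℕ+) ⊆ A ∧ Thick (⋃ f ∈ F, shiftN S f)) := by
  have h13 (hA : DynThick A) := fun (S : Set ℕ+) (hS : PiecewiseSyndetic S) =>
    hA.exists_thick_shift hS
  exact ⟨⟨fun hA B hAB hB => exists_thick_of_superset (h13 hA) hAB hB, dynThick_of_superset⟩,
    ⟨h13, dynThick_of_piecewiseSyndetic⟩⟩
end

section
/- The family of central subsets of ℕ is properly contained in the family of dynamically central piecewise syndetic sets, which is properly contained in the family of dynamically piecewise syndetic sets, and the family of dynamically piecewise syndetic sets equals the family of piecewise syndetic sets; that is, 𝒞 ⊊ dc𝒫𝒮 ⊊ d𝒫𝒮 = 𝒫𝒮. In particular, a set is dynamically piecewise syndetic if and only if it is piecewise syndetic. -/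
open Set

/-- An ultrafilter on `ℕ`, viewed combinatorially: a proper filter of subsets such that for
every set either it or its complement is a member. -/
def IsUltra (p : Set (Set ℕ+)) : Prop :=
  IsFilterFamily p ∧ p.Nonempty ∧ ∅ ∉ p ∧ ∀ S : Set ℕ+, S ∈ p ∨ Sᶜ ∈ p

/-- A left ideal of the semigroup `(βℕ, +)`: a nonempty set `L` of ultrafilters with
`𝔮 + 𝔭 ∈ L` for every ultrafilter `𝔮` and every `𝔭 ∈ L`. -/
def IsLeftIdeal (L : Set (Set (Set ℕ+))) : Prop :=
  (∀ p ∈ L, IsUltra p) ∧ L.Nonempty ∧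
    ∀ q : Set (Set ℕ+), IsUltra q → ∀ p ∈ L, famSum q p ∈ L

/-- A minimal left ideal: a left ideal minimal under inclusion. -/
def IsMinimalLeftIdeal (L : Set (Set (Set ℕ+))) : Prop :=
  IsLeftIdeal L ∧ ∀ L' : Set (Set (Set ℕ+)), IsLeftIdeal L' → L' ⊆ L → L' = L

/-- A set is central if it belongs to an idempotent ultrafilter lying in a minimal left
ideal of `βℕ`. -/
def Central (A : Set ℕ+) : Prop :=
  ∃ p : Set (Set ℕ+), IsUltra p ∧ famSum p p = p ∧
    (∃ L : Set (Set (Set ℕ+)), IsMinimalLeftIdeal L ∧ p ∈ L) ∧ A ∈ p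

/-- Dynamically piecewise syndetic: the intersection of a dynamically syndetic set and a
dynamically thick set. -/
def DynPS (A : Set ℕ+) : Prop :=
  ∃ B C : Set ℕ+, DynSyndetic B ∧ DynThick C ∧ A = B ∩ C

/-- Dynamically central piecewise syndetic: the intersection of a dynamically central
syndetic set and a set of pointwise recurrence. -/
def DynCentralPS (A : Set ℕ+) : Prop :=
  ∃ B C : Set ℕ+, DynCentralSyndetic B ∧ PointwiseRecurrent C ∧ A = B ∩ C

/-- The word of length `L` with support `w` occurs in `Z` at position `s`. -/
def Occurs (w : Set ℕ) (L : ℕ) (Z : Set ℕ) (s : ℕ) : Prop := ∀ j < L, (s + j ∈ Z ↔ j ∈ w)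

/-- Every window of length `K` inside `[x, y)` contains an occurrence of the word `(w, L)`. -/
def Recurs (w : Set ℕ) (L K : ℕ) (Z : Set ℕ) (x y : ℕ) : Prop :=
  ∀ t, x ≤ t → t + K ≤ y → ∃ s, t ≤ s ∧ s + L ≤ t + K ∧ Occurs w L Z s

theorem Recurs.glue {w Z : Set ℕ} {L K x y x' y' s : ℕ} (h : Recurs w L K Z x y)
    (h' : Recurs w L K Z x' y') (hs : Occurs w L Z s) (hx : x' ≤ s) (hy : s + L ≤ y) :
    Recurs w L K Z x y' := by
  intro t ht htK
  by_cases h1 : t + K ≤ y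
  · exact h t ht h1
  by_cases h2 : x' ≤ t
  · exact h' t h2 htK
  exact ⟨s, by omega, by omega, hs⟩

theorem occurs_translate {w Z : Set ℕ} {L x s : ℕ} :
    Occurs w L {j | x + j ∈ Z} s ↔ Occurs w L Z (x + s) := by
  simp only [Occurs, Set.mem_ofPred_eq, add_assoc]

theorem recurs_of_translate {w Z : Set ℕ} {L K x a b : ℕ}
    (h : Recurs w L K {j | x + j ∈ Z} a b) : Recurs w L K Z (x + a) (x + b) := by
  intro t ht htK
  obtain ⟨s, h1, h2, h3⟩ := h (t - x) (by omega) (by omega)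
  exact ⟨x + s, by omega, by omega, occurs_translate.1 h3⟩

/-- A subset of `ℕ` with bounded gaps. -/
def BoundedGaps (S : Set ℕ) : Prop := ∃ g, ∀ a, ∃ s ∈ S, a ≤ s ∧ s ≤ a + g

/-- A subset of `ℕ` whose indicator function is a uniformly recurrent point of the shift. -/
def UniformlyRecurrent (Z : Set ℕ) : Prop :=
  ∀ L, BoundedGaps {s | Occurs Z L Z s}

/-- A finite approximation to a uniformly recurrent subset of `A`: an initial word `(w, L)`,
recurrence constraints `(w', L', K')` on earlier words, which the current word obeys, and the
possibility of filling arbitrary intervals by subsets of `A` respecting all the constraints. -/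
structure Stage (A : Set ℕ) where
  w : Set ℕ
  L : ℕ
  cond : Set (Set ℕ × ℕ × ℕ)
  subset : w ⊆ A
  lt : ∀ j ∈ w, j < L
  word : ∀ c ∈ cond, c.2.1 ≤ L ∧ ∀ Z, Occurs w L Z 0 →
    Occurs c.1 c.2.1 Z 0 ∧ Occurs c.1 c.2.1 Z (L - c.2.1) ∧ Recurs c.1 c.2.1 c.2.2 Z 0 L
  fill : ∀ a b, L ≤ a → a ≤ b → ∃ u ⊆ A, (∀ j ∈ u, a ≤ j ∧ j < b) ∧ ∀ c ∈ cond, ∀ Z,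
    (∀ j, a ≤ j → j < b → (j ∈ Z ↔ j ∈ u)) → Occurs c.1 c.2.1 Z (a - c.2.1) →
      Occurs c.1 c.2.1 Z b → Recurs c.1 c.2.1 c.2.2 Z (a - c.2.1) (b + c.2.1)

theorem Stage.word_at {A : Set ℕ} (σ : Stage A) {c : Set ℕ × ℕ × ℕ} (hc : c ∈ σ.cond)
    {Z : Set ℕ} {x : ℕ} (h : Occurs σ.w σ.L Z x) :
    Occurs c.1 c.2.1 Z x ∧ Occurs c.1 c.2.1 Z (x + (σ.L - c.2.1)) ∧
      Recurs c.1 c.2.1 c.2.2 Z x (x + σ.L) := by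
  obtain ⟨h1, h2, h3⟩ := (σ.word c hc).2 {j | x + j ∈ Z} (occurs_translate.2 h)
  exact ⟨occurs_translate.1 h1, occurs_translate.1 h2, recurs_of_translate h3⟩

theorem Stage.exists_fill_succ {A : Set ℕ} (σ : Stage A) {g K : ℕ} (hK : g + 3 * σ.L < K)
    (hg : ∀ a, ∃ s, (∀ f ∈ σ.w, s + f ∈ A) ∧ a ≤ s ∧ s ≤ a + g) (n : ℕ) :
    ∀ a b, σ.L ≤ a → a ≤ b → b ≤ a + n → ∃ u ⊆ A, (∀ j ∈ u, a ≤ j ∧ j < b) ∧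
      ∀ c ∈ insert (σ.w, σ.L, K) σ.cond, ∀ Z,
      (∀ j, a ≤ j → j < b → (j ∈ Z ↔ j ∈ u)) → Occurs c.1 c.2.1 Z (a - c.2.1) →
      Occurs c.1 c.2.1 Z b → Recurs c.1 c.2.1 c.2.2 Z (a - c.2.1) (b + c.2.1) := by
  induction n using Nat.strong_induction_on with
  | _ n ih =>
  intro a b ha hab hn
  obtain ⟨r, hrA, har, hrg⟩ := hg a
  by_cases hr : r + σ.L ≤ b ∧ 0 < σ.L
  · obtain ⟨hr, hL⟩ := hr
    obtain ⟨u, huA, hu, hfill⟩ := σ.fill a r ha har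
    obtain ⟨v, hvA, hv, hfill'⟩ := ih (b - (r + σ.L)) (by omega) (r + σ.L) b (by omega)
      hr (by omega)
    refine ⟨u ∪ {j | r ≤ j ∧ j - r ∈ σ.w} ∪ v, ?_, ?_, ?_⟩
    · rintro j ((hj | ⟨hj1, hj2⟩) | hj)
      · exact huA hj
      · have := hrA _ hj2
        rwa [Nat.add_sub_cancel' hj1] at this
      · exact hvA hj
    · rintro j ((hj | ⟨hj1, hj2⟩) | hj)
      · have := hu j hj; omega
      · have := σ.lt _ hj2; omega
      · have := hv j hj; omega
    · intro c hc Z hZ hocc1 hocc2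
      have hZu : ∀ j, a ≤ j → j < r → (j ∈ Z ↔ j ∈ u) := by
        intro j h1 h2
        rw [hZ j h1 (by omega)]
        refine ⟨?_, fun h => Or.inl (Or.inl h)⟩
        rintro ((hj | ⟨hj1, hj2⟩) | hj)
        · exact hj
        · omega
        · have := hv j hj; omega
      have hZv : ∀ j, r + σ.L ≤ j → j < b → (j ∈ Z ↔ j ∈ v) := by
        intro j h1 h2
        rw [hZ j (by omega) h2]
        refine ⟨?_, fun h => Or.inr h⟩
        rintro ((hj | ⟨hj1, hj2⟩) | hj)
        · have := hu j hj; omega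
        · have := σ.lt _ hj2; omega
        · exact hj
      have hZw : Occurs σ.w σ.L Z r := by
        intro j hj
        rw [hZ (r + j) (by omega) (by omega)]
        constructor
        · rintro ((hj | ⟨hj1, hj2⟩) | hj)
          · have := hu _ hj; omega
          · simpa using hj2
          · have := hv _ hj; omega
        · intro h
          exact Or.inl (Or.inr ⟨by omega, by simpa using h⟩)
      rcases hc with rfl | hc
      · have h2 := hfill' _ (Set.mem_insert _ _) Z hZv (by simpa using hZw) hocc2
        simp only [Nat.add_sub_cancel] at h2
        have h1 : Recurs σ.w σ.L K Z (a - σ.L) (r + σ.L) := by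
          intro t h1 h2
          omega
        exact h1.glue h2 hZw le_rfl le_rfl
      · have hcL := (σ.word c hc).1
        obtain ⟨h1, h2, h3⟩ := σ.word_at hc hZw
        have e : r + (σ.L - c.2.1) = r + σ.L - c.2.1 := by omega
        rw [e] at h2
        have h4 := hfill c hc Z hZu hocc1 h1
        have h5 := hfill' c (Set.mem_insert_of_mem _ hc) Z hZv h2 hocc2
        exact (h4.glue h3 h1 le_rfl le_rfl).glue h5 h2 le_rfl (by omega)
  · obtain ⟨u, huA, hu, hfill⟩ := σ.fill a b ha hab
    refine ⟨u, huA, hu, ?_⟩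
    rintro c (rfl | hc) Z hZ h1 h2
    · intro t h3 h4
      simp only at h3 h4
      by_cases hL : 0 < σ.L
      · have : ¬ r + σ.L ≤ b := fun h => hr ⟨h, hL⟩
        omega
      · refine ⟨t, le_rfl, by simp only; omega, fun j hj => ?_⟩
        simp only at hj
        omega
    · exact hfill c hc Z hZ h1 h2

theorem Stage.exists_succ {A : Set ℕ}
    (hA : ∀ F : Set ℕ, F.Finite → F ⊆ A → BoundedGaps {s | ∀ f ∈ F, s + f ∈ A}) (σ : Stage A) :
    ∃ τ : Stage A, σ.cond ⊆ τ.cond ∧ (∃ K, (σ.w, σ.L, K) ∈ τ.cond) ∧ σ.L + 1 ≤ τ.L := by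
  obtain ⟨g, hg⟩ := hA σ.w ((Set.finite_lt_nat σ.L).subset fun j hj => σ.lt j hj) σ.subset
  obtain ⟨s, hsA, hLs, -⟩ := hg (σ.L + 1)
  obtain ⟨u, huA, hu, hfill⟩ := σ.fill σ.L s le_rfl (by omega)
  have hfill' := σ.exists_fill_succ (g := g) (K := s + g + 4 * σ.L + 1) (by omega) hg
  refine ⟨⟨σ.w ∪ u ∪ {j | s ≤ j ∧ j - s ∈ σ.w}, s + σ.L,
    insert (σ.w, σ.L, s + g + 4 * σ.L + 1) σ.cond, ?_, ?_, ?_, ?_⟩, ?_, ?_, ?_⟩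
  · rintro j ((hj | hj) | ⟨hj1, hj2⟩)
    · exact σ.subset hj
    · exact huA hj
    · have := hsA _ hj2
      rwa [Nat.add_sub_cancel' hj1] at this
  · rintro j ((hj | hj) | ⟨hj1, hj2⟩)
    · have := σ.lt _ hj; omega
    · have := hu _ hj; omega
    · have := σ.lt _ hj2; omega
  · intro c hc
    have hcL : c.2.1 ≤ σ.L := by
      rcases hc with rfl | hc
      · exact le_rfl
      · exact (σ.word c hc).1
    refine ⟨by omega, fun Z hZ => ?_⟩
    have hZ0 : Occurs σ.w σ.L Z 0 := by
      intro j hj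
      rw [hZ j (by omega)]
      refine ⟨?_, fun h => Or.inl (Or.inl h)⟩
      rintro ((hj | hj) | ⟨hj1, hj2⟩)
      · exact hj
      · have := hu _ hj; omega
      · omega
    have hZs : Occurs σ.w σ.L Z s := by
      intro j hj
      have := hZ (s + j) (by omega)
      rw [zero_add] at this
      rw [this]
      constructor
      · rintro ((hj | hj) | ⟨hj1, hj2⟩)
        · have := σ.lt _ hj; omega
        · have := hu _ hj; omega
        · simpa using hj2
      · intro h
        exact Or.inr ⟨by omega, by simpa using h⟩
    have hZu : ∀ j, σ.L ≤ j → j < s → (j ∈ Z ↔ j ∈ u) := by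
      intro j h1 h2
      have := hZ j (by omega)
      rw [zero_add] at this
      rw [this]
      refine ⟨?_, fun h => Or.inl (Or.inr h)⟩
      rintro ((hj | hj) | ⟨hj1, hj2⟩)
      · have := σ.lt _ hj; omega
      · exact hj
      · omega
    rcases hc with rfl | hc
    · refine ⟨hZ0, by simpa using hZs, fun t h1 h2 => ?_⟩
      simp only at h2
      omega
    · obtain ⟨h1, h2, h3⟩ := σ.word_at hc hZ0
      obtain ⟨h4, h5, h6⟩ := σ.word_at hc hZs
      simp only [zero_add] at h2 h3
      have h7 := hfill c hc Z hZu h2 h4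
      refine ⟨h1, ?_, ?_⟩
      · rwa [Nat.add_sub_assoc hcL]
      · exact (h3.glue h7 h2 le_rfl (by omega)).glue h6 h4 le_rfl le_rfl
  · intro a b ha hab
    exact hfill' (b - a) a b (by omega) hab (by omega)
  · exact Set.subset_insert _ _
  · exact ⟨_, Set.mem_insert _ _⟩
  · show σ.L + 1 ≤ s + σ.L
    omega

/-- If for every finite `F ⊆ A` the set of `s` with `s + F ⊆ A` has bounded gaps, then every
element of `A` belongs to a uniformly recurrent subset of `A`. -/
theorem exists_uniformlyRecurrent_subset {A : Set ℕ}
    (hA : ∀ F : Set ℕ, F.Finite → F ⊆ A → BoundedGaps {s | ∀ f ∈ F, s + f ∈ A})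
    {n₀ : ℕ} (hn₀ : n₀ ∈ A) : ∃ Z ⊆ A, n₀ ∈ Z ∧ UniformlyRecurrent Z := by
  let σ₀ : Stage A :=
    { w := {n₀}, L := n₀ + 1, cond := ∅
      subset := by simpa using hn₀
      lt := by simp
      word := by simp
      fill := fun a b _ _ => ⟨∅, by simp, by simp, by simp⟩ }
  choose next hcond hnew hL using fun σ : Stage A => σ.exists_succ hA
  let σ : ℕ → Stage A := fun n => next^[n] σ₀
  have hσ : ∀ n, σ (n + 1) = next (σ n) := fun n => Function.iterate_succ_apply' _ _ _
  have hmono : Monotone fun n => (σ n).cond :=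
    monotone_nat_of_le_succ fun n => by rw [hσ]; exact hcond _
  have hLn : ∀ n, n ≤ (σ n).L := by
    intro n
    induction n with
    | zero => exact Nat.zero_le _
    | succ n ih => have := hL (σ n); rw [hσ]; omega
  have hK : ∀ n, ∃ K, ∀ m, n < m → ((σ n).w, (σ n).L, K) ∈ (σ m).cond := by
    intro n
    obtain ⟨K, hK⟩ := hnew (σ n)
    rw [← hσ] at hK
    exact ⟨K, fun m hm => hmono hm hK⟩
  have hself : ∀ n, Occurs (σ n).w (σ n).L (σ n).w 0 := fun n j _ => by rw [zero_add]
  have hpre : ∀ n m, n ≤ m → Occurs (σ n).w (σ n).L (σ m).w 0 := by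
    intro n m hnm
    rcases hnm.eq_or_lt with rfl | h
    · exact hself n
    · obtain ⟨K, hK⟩ := hK n
      exact ((σ m).word_at (hK m h) (hself m)).1
  have hLmono : ∀ n m, n ≤ m → (σ n).L ≤ (σ m).L := by
    intro n m hnm
    rcases hnm.eq_or_lt with rfl | h
    · exact le_rfl
    · obtain ⟨K, hK⟩ := hK n
      exact ((σ m).word _ (hK m h)).1
  have hsub : ∀ n m, n ≤ m → (σ n).w ⊆ (σ m).w := by
    intro n m hnm j hj
    have := (hpre n m hnm j ((σ n).lt j hj)).2 hj
    rwa [zero_add] at this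
  have hZ : ∀ n, Occurs (σ n).w (σ n).L (⋃ m, (σ m).w) 0 := by
    intro n j hj
    rw [zero_add, Set.mem_iUnion]
    refine ⟨?_, fun h => ⟨n, h⟩⟩
    rintro ⟨m, hm⟩
    have h1 := hsub m (max m n) (le_max_left _ _) hm
    have := hpre n (max m n) (le_max_right _ _) j hj
    rw [zero_add] at this
    exact this.1 h1
  refine ⟨⋃ m, (σ m).w, Set.iUnion_subset fun m => (σ m).subset,
    Set.mem_iUnion.2 ⟨0, rfl⟩, fun n => ?_⟩
  obtain ⟨K, hK⟩ := hK n
  refine ⟨K, fun a => ?_⟩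
  have hm : n < n + a + K + 1 := by omega
  obtain ⟨s, h1, h2, h3⟩ := ((σ _).word_at (hK _ hm) (hZ _)).2.2 a (Nat.zero_le _)
    (by have := hLn (n + a + K + 1); simp only; omega)
  refine ⟨s, fun j hj => ?_, h1, by simp only at h2; omega⟩
  have hj' : j < (σ n).L := hj.trans_le (hLn n)
  have := hZ n j hj'
  rw [zero_add] at this
  rw [h3 j hj', this]

open Filter Topology

theorem MinSystem.exists_return (S : MinSystem) {U : Set S.X} (hU : IsOpen U) (hne : U.Nonempty) :
    ∃ g, ∀ x a, ∃ s, S.T^[s] x ∈ U ∧ a + 1 ≤ s ∧ s ≤ a + g := by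
  obtain ⟨t, ht⟩ := isCompact_univ.elim_finite_subcover
    (fun n : ℕ+ => S.T^[(n : ℕ)] ⁻¹' U) (fun n => hU.preimage (S.cont.iterate n)) (by
      intro y _
      obtain ⟨_, ⟨n, rfl⟩, h⟩ := (S.minimal y).exists_mem_open hU hne
      exact Set.mem_iUnion.2 ⟨n, h⟩)
  refine ⟨t.sup (fun n : ℕ+ => (n : ℕ)), fun x a => ?_⟩
  obtain ⟨n, hn, h⟩ := Set.mem_iUnion₂.1 (ht (Set.mem_univ (S.T^[a] x)))
  refine ⟨n + a, ?_, ?_, ?_⟩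
  · rw [Function.iterate_add_apply]
    exact h
  · have := n.pos
    omega
  · have := Finset.le_sup (f := fun n : ℕ+ => (n : ℕ)) hn
    omega

theorem MinSystem.surjective (S : MinSystem) : Function.Surjective S.T := by
  intro x
  obtain ⟨y⟩ := S.nem
  have hcl : IsClosed (Set.range S.T) := (isCompact_range S.cont).isClosed
  have hsub : (Set.range fun n : ℕ+ => S.T^[(n : ℕ)] y) ⊆ Set.range S.T := by
    rintro _ ⟨n, rfl⟩
    refine ⟨S.T^[(n : ℕ) - 1] y, ?_⟩
    rw [← Function.iterate_succ_apply' S.T, Nat.succ_eq_add_one, Nat.sub_add_cancel n.pos]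
  exact closure_minimal hsub hcl (S.minimal y x)

theorem exists_pnat_eq {n : ℕ} (h : 0 < n) : ∃ m : ℕ+, (m : ℕ) = n := ⟨⟨n, h⟩, rfl⟩

theorem PNat.coe_sub_of_lt {m n : ℕ+} (h : m < n) : ((n - m : ℕ+) : ℕ) = n - m := by
  rw [PNat.sub_coe, if_pos h]

theorem Thick.exists_interval {H : Set ℕ+} (hH : Thick H) (N : ℕ) :
    ∃ h : ℕ+, ∀ n : ℕ+, h ≤ n → (n : ℕ) ≤ h + N → n ∈ H := by
  obtain ⟨k, hk⟩ := exists_pnat_eq (Nat.succ_pos N)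
  obtain ⟨m, hm⟩ := hH (Finset.Icc 1 k)
  refine ⟨m + 1, fun n h1 h2 => ?_⟩
  have hlt : m < n := lt_of_lt_of_le (PNat.lt_add_right m 1) h1
  have := hm (n - m) (Finset.mem_Icc.2 ⟨one_le, by
    rw [← PNat.coe_le_coe, PNat.coe_sub_of_lt hlt]
    rw [PNat.add_coe, PNat.one_coe] at h2
    omega⟩)
  rwa [add_comm, PNat.add_sub_of_lt hlt] at this

theorem thick_of_forall_interval {H : Set ℕ+}
    (h : ∀ N : ℕ, ∃ m : ℕ, ∀ n : ℕ+, m < n → (n : ℕ) ≤ m + N → n ∈ H) : Thick H := by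
  intro F
  obtain ⟨m, hm⟩ := h (F.sup (fun n : ℕ+ => (n : ℕ)) + 1)
  obtain ⟨k, hk⟩ := exists_pnat_eq (Nat.succ_pos m)
  refine ⟨k, fun f hf => hm _ ?_ ?_⟩
  · rw [PNat.add_coe]
    omega
  · have : (f : ℕ) ≤ F.sup (fun n : ℕ+ => (n : ℕ)) :=
      Finset.le_sup (f := fun n : ℕ+ => (n : ℕ)) hf
    rw [PNat.add_coe]
    omega

theorem thick_of_not_boundedGaps {S : Set ℕ} (hS : ¬ BoundedGaps S) :
    Thick {n : ℕ+ | (n : ℕ) ∉ S} := by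
  refine thick_of_forall_interval fun N => ?_
  simp only [BoundedGaps, not_exists, not_forall] at hS
  obtain ⟨a, ha⟩ := hS N
  exact ⟨a, fun n h1 h2 hn => ha n ⟨hn, by omega, h2⟩⟩

theorem Thick.inter_retTimes {H : Set ℕ+} (hH : Thick H) (S : MinSystem) (x : S.X) {U : Set S.X}
    (hU : IsOpen U) (hne : U.Nonempty) : ∃ n ∈ H, S.T^[(n : ℕ)] x ∈ U := by
  obtain ⟨g, hg⟩ := S.exists_return hU hne
  obtain ⟨h, hh⟩ := hH.exists_interval g
  obtain ⟨s, hs, h1, h2⟩ := hg x h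
  obtain ⟨n, rfl⟩ := exists_pnat_eq (n := s) (by omega)
  exact ⟨n, hh n (by rw [← PNat.coe_le_coe]; omega) h2, hs⟩

theorem Thick.pointwiseRecurrent {H : Set ℕ+} (hH : Thick H) : PointwiseRecurrent H :=
  fun S x _ hU hx => hH.inter_retTimes S x hU ⟨x, hx⟩

theorem Thick.dynThick {H : Set ℕ+} (hH : Thick H) : DynThick H := by
  intro S x
  rw [dense_iff_inter_open]
  intro U hU hne
  obtain ⟨n, hn, h⟩ := hH.inter_retTimes S x hU hne
  exact ⟨_, h, n, hn, rfl⟩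

theorem Thick.mono {H K : Set ℕ+} (hH : Thick H) (hHK : H ⊆ K) : Thick K := fun F =>
  (hH F).imp fun _ h f hf => hHK (h f hf)

/-- The shift on the space of binary sequences. -/
def seqShift (v : ℕ → Bool) : ℕ → Bool := fun j => v (j + 1)

theorem seqShift_iterate (n : ℕ) (v : ℕ → Bool) (j : ℕ) : seqShift^[n] v j = v (j + n) := by
  induction n generalizing v with
  | zero => rfl
  | succ n ih =>
    rw [Function.iterate_succ_apply, ih]
    rfl

theorem continuous_seqShift : Continuous seqShift :=
  continuous_pi fun j => continuous_apply (j + 1)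

theorem exists_initial_word_subset {V : Set (ℕ → Bool)} (hV : IsOpen V) {v : ℕ → Bool} (hv : v ∈ V) :
    ∃ L, ∀ u : ℕ → Bool, (∀ j < L, u j = v j) → u ∈ V := by
  obtain ⟨_, ⟨y, L, rfl⟩, h1, h2⟩ :=
    (PiNat.isTopologicalBasis_cylinders (fun _ : ℕ => Bool)).exists_subset_of_mem_open hv hV
  refine ⟨L, fun u hu => h2 ?_⟩
  rw [← PiNat.mem_cylinder_iff_eq.1 h1]
  exact hu

theorem UniformlyRecurrent.exists_iterate_mem {Z : Set ℕ} (hZ : UniformlyRecurrent Z)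
    {x y a : ℕ → Bool} (hx : ∀ n, x n = true ↔ n ∈ Z)
    (hy : y ∈ closure (Set.range fun n : ℕ => seqShift^[n] x))
    (ha : a ∈ closure (Set.range fun n : ℕ => seqShift^[n] x)) {V : Set (ℕ → Bool)}
    (hV : IsOpen V) (haV : a ∈ V) : ∃ n : ℕ+, seqShift^[(n : ℕ)] y ∈ V := by
  obtain ⟨_, hm, ⟨m, rfl⟩⟩ := mem_closure_iff.1 ha V hV haV
  obtain ⟨L, hL⟩ := exists_initial_word_subset hV hm
  obtain ⟨K, hK⟩ := hZ (L + m)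
  obtain ⟨_, hn, ⟨n, rfl⟩⟩ := mem_closure_iff.1 hy _
    (PiNat.isOpen_cylinder (fun _ : ℕ => Bool) y (K + 1 + L + m)) (PiNat.self_mem_cylinder _ _)
  obtain ⟨s, hs, h1, h2⟩ := hK (n + 1)
  refine ⟨⟨s - n + m, by omega⟩, hL _ fun j hj => ?_⟩
  have e1 := hn (j + (s - n + m)) (by omega)
  simp only [seqShift_iterate, PNat.mk_coe] at e1 ⊢
  rw [← e1, Bool.eq_iff_iff, hx, hx, show j + (s - n + m) + n = s + (j + m) by omega]
  exact hs (j + m) (by omega)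

theorem UniformlyRecurrent.exists_minSystem {Z : Set ℕ} (hZ : UniformlyRecurrent Z) :
    ∃ (S : MinSystem) (x : S.X) (U : Set S.X), IsOpen U ∧ ∀ n, S.T^[n] x ∈ U ↔ n ∈ Z := by
  classical
  let x : ℕ → Bool := fun n => decide (n ∈ Z)
  have hx : ∀ n, x n = true ↔ n ∈ Z := fun n => decide_eq_true_iff
  let X : Set (ℕ → Bool) := closure (Set.range fun n : ℕ => seqShift^[n] x)
  have hmaps : Set.MapsTo seqShift X X := by
    refine Set.MapsTo.closure ?_ continuous_seqShift
    rintro _ ⟨n, rfl⟩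
    exact ⟨n + 1, Function.iterate_succ_apply' _ _ _⟩
  have hxX : x ∈ X := subset_closure ⟨0, rfl⟩
  let T : X → X := hmaps.restrict
  have hT : ∀ (n : ℕ) (y : X), (T^[n] y : ℕ → Bool) = seqShift^[n] y := by
    intro n y
    rw [hmaps.iterate_restrict]
    rfl
  let _ : MetricSpace X := TopologicalSpace.metrizableSpaceMetric X
  have : CompactSpace X := isCompact_iff_compactSpace.1 isClosed_closure.isCompact
  have : Nonempty X := ⟨⟨x, hxX⟩⟩
  have hmin : MinimalMap T := by
    intro y
    rw [dense_iff_inter_open]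
    rintro _ ⟨V, hV, rfl⟩ ⟨a, ha⟩
    obtain ⟨n, hn⟩ := hZ.exists_iterate_mem hx y.2 a.2 hV ha
    refine ⟨_, ?_, n, rfl⟩
    rw [Set.mem_preimage, hT]
    exact hn
  refine ⟨{ X := X, T := T, cont := continuous_seqShift.restrict hmaps, minimal := hmin },
    ⟨x, hxX⟩, {y | (y : ℕ → Bool) 0 = true}, ?_, fun n => ?_⟩
  · exact (isOpen_discrete ({true} : Set Bool)).preimage
      ((continuous_apply (A := fun _ : ℕ => Bool) 0).comp continuous_subtype_val)
  · show (T^[n] ⟨x, hxX⟩ : ℕ → Bool) 0 = true ↔ _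
    rw [hT, seqShift_iterate, hx, zero_add]

theorem UniformlyRecurrent.dynCentralSyndetic {Z : Set ℕ} (hZ : UniformlyRecurrent Z)
    (h0 : 0 ∈ Z) : DynCentralSyndetic {n : ℕ+ | (n : ℕ) ∈ Z} := by
  obtain ⟨S, x, U, hU, h⟩ := hZ.exists_minSystem
  exact ⟨S, x, U, hU, (h 0).2 h0, fun n hn => (h n).1 hn⟩

theorem boundedGaps_of_not_piecewiseSyndetic {A : Set ℕ+} (hA : ¬ PiecewiseSyndetic A) (N : ℕ) :
    BoundedGaps {s : ℕ | ∀ n : ℕ+, s ≤ n → (n : ℕ) ≤ s + N → n ∉ A} := by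
  simp only [PiecewiseSyndetic, Thick, not_exists, not_forall] at hA
  obtain ⟨k, hk⟩ := exists_pnat_eq (Nat.succ_pos N)
  obtain ⟨F, hF⟩ := hA k
  refine ⟨F.sup (fun n : ℕ+ => (n : ℕ)) + 1, fun a => ?_⟩
  obtain ⟨b, hb⟩ := exists_pnat_eq (Nat.succ_pos a)
  obtain ⟨f, hf, hfA⟩ := hF b
  have hle : (f : ℕ) ≤ F.sup (fun n : ℕ+ => (n : ℕ)) :=
    Finset.le_sup (f := fun n : ℕ+ => (n : ℕ)) hf
  simp only [Set.mem_union, Set.mem_iUnion, not_or, not_exists] at hfA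
  refine ⟨(f + b : ℕ+), fun n h1 h2 hn => ?_, ?_, ?_⟩
  · rw [PNat.coe_le_coe] at h1
    rcases h1.eq_or_lt with rfl | h
    · exact hfA.1 hn
    · refine hfA.2 (n - (f + b)) ?_ ?_
      · rw [Set.mem_ofPred_eq, ← PNat.coe_le_coe, PNat.coe_sub_of_lt h]
        omega
      · show _ + _ ∈ A
        rwa [PNat.add_sub_of_lt h]
  · rw [PNat.add_coe]
    omega
  · rw [PNat.add_coe]
    omega

theorem boundedGaps_retTimes_of_not_piecewiseSyndetic {A : Set ℕ+} (hA : ¬ PiecewiseSyndetic A)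
    (S : MinSystem) (x : S.X) {U : Set S.X} (hU : IsOpen U) (hne : U.Nonempty) (N : ℕ) :
    BoundedGaps {s : ℕ | S.T^[s] x ∈ U ∧ ∀ n : ℕ+, s ≤ n → (n : ℕ) ≤ s + N → n ∉ A} := by
  obtain ⟨g, hg⟩ := S.exists_return hU hne
  obtain ⟨g', hg'⟩ := boundedGaps_of_not_piecewiseSyndetic hA (N + g)
  refine ⟨g' + g, fun a => ?_⟩
  obtain ⟨s, hs, h1, h2⟩ := hg' a
  obtain ⟨r, hr, h3, h4⟩ := hg x s
  exact ⟨r, ⟨hr, fun n h5 h6 => hs n (by omega) (by omega)⟩, by omega, by omega⟩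

theorem MinSystem.isOpen_biInter (S : MinSystem) {U : Set S.X} (hU : IsOpen U) {F : Set ℕ}
    (hF : F.Finite) : IsOpen (⋂ f ∈ F, S.T^[f] ⁻¹' U) :=
  hF.isOpen_biInter fun f _ => hU.preimage (S.cont.iterate f)

theorem exists_uniformlyRecurrent_avoiding {A : Set ℕ+} (hA : ¬ PiecewiseSyndetic A)
    (S : MinSystem) (x : S.X) {U : Set S.X} (hU : IsOpen U) {n₀ : ℕ} (hn₀ : S.T^[n₀] x ∈ U)
    (hn₀A : ∀ n : ℕ+, n ∈ A → (n : ℕ) ≠ n₀) :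
    ∃ Z : Set ℕ, UniformlyRecurrent Z ∧ n₀ ∈ Z ∧ ∀ n : ℕ+,
      (n : ℕ) ∈ Z → S.T^[(n : ℕ)] x ∈ U ∧ n ∉ A := by
  obtain ⟨Z, hZ, h0, hrec⟩ := exists_uniformlyRecurrent_subset
    (A := {s : ℕ | S.T^[s] x ∈ U ∧ ∀ n : ℕ+, n ∈ A → (n : ℕ) ≠ s}) (by
      intro F hF hFA
      obtain ⟨N, hN⟩ := hF.bddAbove
      obtain ⟨g, hg⟩ := boundedGaps_retTimes_of_not_piecewiseSyndetic hA S x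
        (S.isOpen_biInter hU hF) ⟨x, Set.mem_iInter₂.2 fun f hf => (hFA hf).1⟩ N
      refine ⟨g, fun a => ?_⟩
      obtain ⟨s, ⟨hs1, hs2⟩, h⟩ := hg a
      refine ⟨s, fun f hf => ⟨?_, fun n hn hnf => ?_⟩, h⟩
      · rw [add_comm, Function.iterate_add_apply]
        exact Set.mem_iInter₂.1 hs1 f hf
      · have := hN hf
        exact hs2 n (by omega) (by omega) hn) ⟨hn₀, hn₀A⟩
  exact ⟨Z, hrec, h0, fun n hn => ⟨(hZ hn).1, fun h => (hZ hn).2 n h rfl⟩⟩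

theorem DynCentralPS.piecewiseSyndetic {A : Set ℕ+} (h : DynCentralPS A) :
    PiecewiseSyndetic A := by
  obtain ⟨B, C, ⟨S, x, U, hU, hx, hB⟩, hC, rfl⟩ := h
  by_contra hA
  obtain ⟨Z, hZ, h0, hsub⟩ := exists_uniformlyRecurrent_avoiding hA S x hU (n₀ := 0) hx
    fun n _ => n.ne_zero
  obtain ⟨S', y, V, hV, hy⟩ := hZ.exists_minSystem
  obtain ⟨c, hc, hcV⟩ := hC S' y V hV ((hy 0).2 h0)
  obtain ⟨h1, h2⟩ := hsub c ((hy c).1 hcV)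
  exact h2 ⟨hB h1, hc⟩

theorem DynPS.piecewiseSyndetic {A : Set ℕ+} (h : DynPS A) : PiecewiseSyndetic A := by
  obtain ⟨B, C, ⟨S, x, U, hU, hne, hB⟩, hC, rfl⟩ := h
  by_contra hA
  obtain ⟨g, hg⟩ := boundedGaps_retTimes_of_not_piecewiseSyndetic hA S x hU hne 0
  obtain ⟨n₀, ⟨hn₀, hn₀A⟩, -⟩ := hg 0
  obtain ⟨Z, hZ, h0, hsub⟩ := exists_uniformlyRecurrent_avoiding hA S x hU hn₀
    fun n hn hnn => hn₀A n (by omega) (by omega) hn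
  obtain ⟨S', y, V, hV, hy⟩ := hZ.exists_minSystem
  obtain ⟨_, ⟨c, hc, rfl⟩, hcV⟩ := (hC S' y).exists_mem_open hV ⟨_, (hy n₀).2 h0⟩
  obtain ⟨h1, h2⟩ := hsub c ((hy c).1 hcV)
  exact h2 ⟨hB h1, hc⟩

attribute [local instance] Ultrafilter.add Ultrafilter.addSemigroup

theorem mem_shiftN {A : Set ℕ+} {m n : ℕ+} : m ∈ shiftN A n ↔ m + n ∈ A := Iff.rfl

theorem mem_of_coe_eq {A : Set ℕ+} {a b : ℕ+} (h : (a : ℕ) = b) (ha : a ∈ A) : b ∈ A :=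
  PNat.eq h ▸ ha

theorem shiftN_shiftN (A : Set ℕ+) (m n : ℕ+) : shiftN (shiftN A n) m = shiftN A (m + n) := by
  ext k
  simp only [mem_shiftN, add_assoc]

theorem Ultrafilter.mem_add_iff {u v : Ultrafilter ℕ+} {A : Set ℕ+} :
    A ∈ u + v ↔ ∀ᶠ n in u, shiftN A n ∈ v := by
  have h : ∀ n, shiftN A n = {m | n + m ∈ A} := fun n => by
    ext m
    rw [mem_shiftN, add_comm, Set.mem_ofPred_eq]
  simp only [h]
  exact Ultrafilter.eventually_add u v (· ∈ A)

/-- An idempotent ultrafilter contained in every left ideal that it generates. -/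
def IsMinimalIdempotent (p : Ultrafilter ℕ+) : Prop := p + p = p ∧ ∀ q, ∃ r, r + (q + p) = p

theorem IsUltra.exists_ultrafilter {P : Set (Set ℕ+)} (hP : IsUltra P) :
    ∃ u : Ultrafilter ℕ+, {A | A ∈ u} = P := by
  obtain ⟨⟨hup, hinter⟩, ⟨B, hB⟩, hempty, hultra⟩ := hP
  refine ⟨Ultrafilter.ofComplNotMemIff
    { sets := P
      univ_sets := hup hB (Set.subset_univ B)
      sets_of_superset := fun h1 h2 => hup h1 h2
      inter_sets := fun h1 h2 => hinter h1 h2 } fun s => ⟨fun h => ?_, fun h hc => ?_⟩, rfl⟩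
  · exact (hultra s).resolve_right h
  · exact hempty (Set.inter_compl_self s ▸ hinter h hc)

theorem Ultrafilter.isUltra (u : Ultrafilter ℕ+) : IsUltra {A | A ∈ u} :=
  ⟨⟨fun _ _ h1 h2 => Filter.mem_of_superset h1 h2, fun _ _ h1 h2 => Filter.inter_mem h1 h2⟩,
    ⟨Set.univ, Filter.univ_mem⟩, u.empty_notMem, fun s => u.mem_or_compl_mem s⟩

theorem Ultrafilter.famSum_eq (u v : Ultrafilter ℕ+) :
    famSum {A | A ∈ u} {A | A ∈ v} = {A | A ∈ u + v} :=
  Set.ext fun _ => Ultrafilter.mem_add_iff.symm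

theorem Ultrafilter.family_injective :
    Function.Injective fun u : Ultrafilter ℕ+ => {A : Set ℕ+ | A ∈ u} :=
  fun _ _ h => Ultrafilter.ext fun s => Set.ext_iff.1 h s

theorem Central.exists_isMinimalIdempotent {A : Set ℕ+} (hA : Central A) :
    ∃ p, IsMinimalIdempotent p ∧ A ∈ p := by
  obtain ⟨P, hP, hid, ⟨L, ⟨⟨hLu, -, hLadd⟩, hLmin⟩, hPL⟩, hAP⟩ := hA
  obtain ⟨p, rfl⟩ := hP.exists_ultrafilter
  refine ⟨p, ⟨Ultrafilter.family_injective ?_, fun q => ?_⟩, hAP⟩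
  · exact (Ultrafilter.famSum_eq p p).symm.trans hid
  have hL' : IsLeftIdeal (Set.range fun r : Ultrafilter ℕ+ => {A | A ∈ r + (q + p)}) := by
    refine ⟨?_, ⟨_, p, rfl⟩, ?_⟩
    · rintro _ ⟨r, rfl⟩
      exact Ultrafilter.isUltra _
    · rintro Q hQ _ ⟨r, rfl⟩
      obtain ⟨s, rfl⟩ := hQ.exists_ultrafilter
      refine ⟨s + r, ?_⟩
      dsimp only
      rw [Ultrafilter.famSum_eq, add_assoc]
  have hsub : (Set.range fun r : Ultrafilter ℕ+ => {A | A ∈ r + (q + p)}) ⊆ L := by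
    rintro _ ⟨r, rfl⟩
    dsimp only
    rw [← Ultrafilter.famSum_eq, ← Ultrafilter.famSum_eq]
    exact hLadd _ r.isUltra _ (hLadd _ q.isUltra _ hPL)
  obtain ⟨r, hr⟩ := (hLmin _ hL' hsub).symm ▸ hPL
  exact ⟨r, Ultrafilter.family_injective hr⟩

/-- The left ideal of the ultrafilters containing all the translates of `H`. -/
def thickIdeal (H : Set ℕ+) : Set (Ultrafilter ℕ+) := {p | ∀ n, shiftN H n ∈ p}

theorem isClosed_thickIdeal (H : Set ℕ+) : IsClosed (thickIdeal H) := by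
  rw [thickIdeal, Set.ofPred_forall]
  exact isClosed_iInter fun n => ultrafilter_isClosed_basic _

theorem add_mem_thickIdeal {H : Set ℕ+} (q : Ultrafilter ℕ+) {p : Ultrafilter ℕ+}
    (hp : p ∈ thickIdeal H) : q + p ∈ thickIdeal H := fun n =>
  Ultrafilter.mem_add_iff.2 <| Filter.Eventually.of_forall fun m => by
    rw [shiftN_shiftN]
    exact hp _

theorem mem_of_idempotent {H : Set ℕ+} {p : Ultrafilter ℕ+} (hp : p ∈ thickIdeal H)
    (hid : p + p = p) : H ∈ p := by
  rw [← hid]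
  exact Ultrafilter.mem_add_iff.2 (Filter.Eventually.of_forall hp)

theorem Thick.exists_translate {H : Set ℕ+} (hH : Thick H) (N : ℕ) :
    ∃ s : ℕ+, ∀ n : ℕ+, (n : ℕ) ≤ N → s + n ∈ H := by
  obtain ⟨h, hh⟩ := hH.exists_interval N
  refine ⟨h, fun n hn => hh _ (PNat.lt_add_right h n).le ?_⟩
  rw [PNat.add_coe]
  omega

theorem Thick.nonempty_thickIdeal {H : Set ℕ+} (hH : Thick H) : (thickIdeal H).Nonempty := by
  choose s hs using hH.exists_translate
  refine ⟨Ultrafilter.of (Filter.map s atTop), fun n => Ultrafilter.of_le _ (Filter.mem_map.2 ?_)⟩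
  filter_upwards [eventually_ge_atTop (n : ℕ)] with N hN using hs N n hN

theorem Thick.exists_isMinimalIdempotent {H : Set ℕ+} (hH : Thick H) :
    ∃ p, IsMinimalIdempotent p ∧ H ∈ p := by
  obtain ⟨N, hN⟩ := zorn_superset {N : Set (Ultrafilter ℕ+) | IsClosed N ∧ N.Nonempty ∧
      (∀ q, ∀ p ∈ N, q + p ∈ N) ∧ N ⊆ thickIdeal H} (by
    intro c hc hchain
    rcases c.eq_empty_or_nonempty with rfl | hne
    · exact ⟨thickIdeal H, ⟨isClosed_thickIdeal H, hH.nonempty_thickIdeal,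
        fun q p hp => add_mem_thickIdeal q hp, subset_rfl⟩, by simp⟩
    · refine ⟨⋂₀ c, ⟨isClosed_sInter fun t ht => (hc ht).1, ?_, fun q p hp t ht =>
        (hc ht).2.2.1 q p (hp t ht), ?_⟩, fun t ht => Set.sInter_subset_of_mem ht⟩
      · have := hne.to_subtype
        exact IsCompact.nonempty_sInter_of_directed_nonempty_isCompact_isClosed
          (fun s hs t ht => (hchain.total hs ht).elim (fun h => ⟨s, hs, subset_rfl, h⟩)
            fun h => ⟨t, ht, h, subset_rfl⟩)
          (fun t ht => (hc ht).2.1) (fun t ht => (hc ht).1.isCompact)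
          (fun t ht => (hc ht).1)
      · obtain ⟨t, ht⟩ := hne
        exact (Set.sInter_subset_of_mem ht).trans (hc ht).2.2.2)
  obtain ⟨hcl, hne, hadd, hsub⟩ := hN.prop
  obtain ⟨p, hp, hid⟩ := exists_idempotent_in_compact_add_subsemigroup
    Ultrafilter.continuous_add_left N hne hcl.isCompact (fun q _ p hp => hadd q p hp)
  refine ⟨p, ⟨hid, fun q => ?_⟩, mem_of_idempotent (hsub hp) hid⟩
  have hrange : Set.range (· + (q + p)) ⊆ N := by
    rintro _ ⟨r, rfl⟩
    exact hadd _ _ (hadd _ _ hp)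
  refine hN.le_of_le (y := Set.range (· + (q + p)))
    ⟨?_, ⟨_, p, rfl⟩, ?_, hrange.trans hsub⟩ hrange hp
  · exact (isCompact_range (Ultrafilter.continuous_add_left _)).isClosed
  · rintro s _ ⟨r, rfl⟩
    exact ⟨s + r, add_assoc _ _ _⟩

theorem IsMinimalIdempotent.boundedGaps {p : Ultrafilter ℕ+} (hp : IsMinimalIdempotent p)
    {G : Set ℕ+} (hG : G ∈ p) : BoundedGaps {s : ℕ | ∃ n : ℕ+, (n : ℕ) = s ∧ shiftN G n ∈ p} := by
  by_contra hgap
  obtain ⟨q, hq⟩ := (thick_of_not_boundedGaps hgap).nonempty_thickIdeal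
  obtain ⟨r, hr⟩ := hp.2 q
  rw [← hr, Ultrafilter.mem_add_iff] at hG
  obtain ⟨a, ha⟩ := hG.exists
  rw [Ultrafilter.mem_add_iff] at ha
  obtain ⟨b, hb, hb'⟩ := (ha.and (hq a)).exists
  rw [shiftN_shiftN] at hb
  exact hb' ⟨_, rfl, hb⟩

theorem Thick.exists_idempotent_retTimes {H : Set ℕ+} (hH : Thick H) (S : MinSystem) (x : S.X) :
    ∃ p : Ultrafilter ℕ+, p + p = p ∧ H ∈ p ∧ ∀ U, IsOpen U → x ∈ U → retTimes S.T x U ∈ p := by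
  have key : ∀ N : ℕ, ∃ s : ℕ+, S.T^[(s : ℕ)] x ∈ Metric.ball x (1 / ((N : ℝ) + 1)) ∧
      ∀ n : ℕ+, (n : ℕ) ≤ N → s + n ∈ H := by
    intro N
    obtain ⟨g, hg⟩ := S.exists_return
      (Metric.isOpen_ball (x := x) (ε := 1 / ((N : ℝ) + 1)))
      ⟨x, Metric.mem_ball_self Nat.one_div_pos_of_nat⟩
    obtain ⟨h, hh⟩ := hH.exists_interval (g + N)
    obtain ⟨s, hs, h1, h2⟩ := hg x h
    obtain ⟨s, rfl⟩ := exists_pnat_eq (n := s) (by omega)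
    refine ⟨s, hs, fun n hn => hh _ ?_ ?_⟩
    · rw [← PNat.coe_le_coe, PNat.add_coe]
      omega
    · rw [PNat.add_coe]
      omega
  choose s hs hsH using key
  obtain ⟨p, ⟨hp, hpU⟩, hid⟩ := exists_idempotent_in_compact_add_subsemigroup
    Ultrafilter.continuous_add_left
    (thickIdeal H ∩ {p | ∀ U, IsOpen U → x ∈ U → retTimes S.T x U ∈ p})
    (by
      refine ⟨Ultrafilter.of (Filter.map s atTop),
        fun n => Ultrafilter.of_le _ (Filter.mem_map.2 ?_),
        fun U hU hx => Ultrafilter.of_le _ (Filter.mem_map.2 ?_)⟩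
      · filter_upwards [eventually_ge_atTop (n : ℕ)] with N hN using hsH N n hN
      · obtain ⟨ε, hε, hball⟩ := Metric.isOpen_iff.1 hU x hx
        obtain ⟨M, hM⟩ := exists_nat_one_div_lt hε
        filter_upwards [eventually_ge_atTop M] with N hN
        exact hball (Metric.ball_subset_ball
          ((Nat.one_div_le_one_div hN).trans hM.le) (hs N)))
    (by
      refine ((isClosed_thickIdeal H).inter ?_).isCompact
      simp only [Set.ofPred_forall]
      exact isClosed_iInter fun U => isClosed_iInter fun _ => isClosed_iInter fun _ =>
        ultrafilter_isClosed_basic _)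
    (by
      rintro p ⟨-, hpU⟩ q ⟨hq, hqU⟩
      refine ⟨add_mem_thickIdeal p hq, fun U hU hx => Ultrafilter.mem_add_iff.2 ?_⟩
      filter_upwards [hpU U hU hx] with m hm
      filter_upwards [hqU _ (hU.preimage (S.cont.iterate m)) hm] with n hn
      rw [mem_shiftN, add_comm]
      show S.T^[((m + n : ℕ+) : ℕ)] x ∈ U
      rw [PNat.add_coe, Function.iterate_add_apply]
      exact hn)
  exact ⟨p, hid, mem_of_idempotent hp hid, hpU⟩

theorem eventually_dvd_of_idempotent {p : Ultrafilter ℕ+} (hp : p + p = p) {k : ℕ} (hk : 0 < k) :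
    ∀ᶠ n : ℕ+ in p, k ∣ (n : ℕ) := by
  have : NeZero k := ⟨hk.ne'⟩
  obtain ⟨c, hc⟩ := Ultrafilter.eq_pure_of_finite (p.map fun n : ℕ+ => ((n : ℕ) : ZMod k))
  have hev : ∀ᶠ n : ℕ+ in p, ((n : ℕ) : ZMod k) = c := by
    have : ({c} : Set (ZMod k)) ∈ p.map fun n : ℕ+ => ((n : ℕ) : ZMod k) := by
      rw [hc]
      exact Ultrafilter.mem_pure.2 rfl
    exact this
  have hev' : {n : ℕ+ | ((n : ℕ) : ZMod k) = c} ∈ p + p := by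
    rw [hp]
    exact hev
  obtain ⟨m, hm, hm'⟩ := (hev.and (Ultrafilter.mem_add_iff.1 hev')).exists
  obtain ⟨n, hn, hn'⟩ := (hev.and hm').exists
  have h0 : c = 0 := by
    have : ((n + m : ℕ+) : ZMod k) = c := hn'
    rw [PNat.add_coe, Nat.cast_add, hn, hm] at this
    exact left_eq_add.1 this.symm
  filter_upwards [hev] with n hn
  rwa [← ZMod.natCast_eq_zero_iff, ← h0]

theorem eventually_gt_of_idempotent {p : Ultrafilter ℕ+} (hp : p + p = p) (M : ℕ) :
    ∀ᶠ n : ℕ+ in p, M < (n : ℕ) := by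
  filter_upwards [eventually_dvd_of_idempotent hp M.succ_pos] with n hn
  exact Nat.le_of_dvd n.pos hn

theorem MinSystem.boundedGaps_dvd (S : MinSystem) {x : S.X} {U : Set S.X} (hU : IsOpen U)
    (hx : x ∈ U) {k : ℕ} (hk : 0 < k) : BoundedGaps {s : ℕ | S.T^[s] x ∈ U ∧ k ∣ s} := by
  by_contra hgap
  obtain ⟨p, hid, hH, hpU⟩ :=
    (thick_of_not_boundedGaps hgap).exists_idempotent_retTimes S x
  obtain ⟨n, hn, hn', hk⟩ :=
    (Filter.Eventually.and hH (Filter.Eventually.and (hpU U hU hx)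
      (eventually_dvd_of_idempotent hid hk))).exists
  exact hn ⟨hn', hk⟩

theorem IsMinimalIdempotent.exists_uniformlyRecurrent {p : Ultrafilter ℕ+}
    (hp : IsMinimalIdempotent p) {A : Set ℕ+} (hA : A ∈ p) :
    ∃ Z, UniformlyRecurrent Z ∧ 0 ∈ Z ∧ Thick {n : ℕ+ | n ∈ A ↔ (n : ℕ) ∈ Z} := by
  let Z : Set ℕ := {n | n = 0 ∨ ∃ m : ℕ+, (m : ℕ) = n ∧ shiftN A m ∈ p}
  have hZ : ∀ m : ℕ+, (m : ℕ) ∈ Z ↔ shiftN A m ∈ p := fun m =>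
    ⟨fun h => h.elim (fun h => (m.ne_zero h).elim) fun ⟨_, h, h'⟩ => PNat.eq h ▸ h',
      fun h => Or.inr ⟨m, rfl, h⟩⟩
  let G : ℕ → Set ℕ+ := fun L => {h | ∀ j < L, ((∃ a ∈ A, (a : ℕ) = h + j) ↔ j ∈ Z)}
  have hG : ∀ L, G L ∈ p := by
    intro L
    have : ∀ j ∈ Set.Iio L, ∀ᶠ h : ℕ+ in p, ((∃ a ∈ A, (a : ℕ) = h + j) ↔ j ∈ Z) := by
      intro j _
      rcases Nat.eq_zero_or_pos j with rfl | hj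
      · filter_upwards [hA] with h hh
        exact ⟨fun _ => Or.inl rfl, fun _ => ⟨h, hh, rfl⟩⟩
      · obtain ⟨m, rfl⟩ := exists_pnat_eq hj
        have hex : ∀ h : ℕ+, (∃ a ∈ A, (a : ℕ) = h + m) ↔ h ∈ shiftN A m := fun h =>
          ⟨fun ⟨a, ha, h'⟩ => mem_shiftN.2 (mem_of_coe_eq h' ha), fun h' => ⟨_, h', rfl⟩⟩
        simp only [hex, hZ]
        by_cases hm : shiftN A m ∈ p
        · filter_upwards [hm] with h hh
          exact iff_of_true hh hm
        · filter_upwards [Ultrafilter.compl_mem_iff_notMem.2 hm] with h hh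
          exact iff_of_false hh hm
    exact (Filter.eventually_all_finite (Set.finite_Iio L)).2 this
  have hocc : ∀ L (n : ℕ+), shiftN (G L) n ∈ p → Occurs Z L Z n := by
    intro L n hn j hj
    obtain ⟨m, hm⟩ := exists_pnat_eq (n := n + j) (by have := n.pos; omega)
    rw [← hm, hZ]
    have hev : ∀ᶠ h : ℕ+ in p, (h ∈ shiftN A m ↔ j ∈ Z) := by
      filter_upwards [hn] with h hh
      rw [← hh j hj]
      have hcoe : ((h + m : ℕ+) : ℕ) = ((h + n : ℕ+) : ℕ) + j := by
        rw [PNat.add_coe, PNat.add_coe, hm, add_assoc]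
      exact ⟨fun h' => ⟨_, h', hcoe⟩, fun ⟨a, ha, h'⟩ =>
        mem_shiftN.2 (mem_of_coe_eq (h'.trans hcoe.symm) ha)⟩
    constructor
    · intro h
      obtain ⟨k, hk, hk'⟩ := (hev.and h).exists
      exact hk.1 hk'
    · intro h
      filter_upwards [hev] with k hk using hk.2 h
  refine ⟨Z, fun L => ?_, Or.inl rfl, thick_of_forall_interval fun N => ?_⟩
  · obtain ⟨g, hg⟩ := hp.boundedGaps (hG L)
    refine ⟨g, fun a => ?_⟩
    obtain ⟨_, ⟨n, rfl, hn⟩, h⟩ := hg a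
    exact ⟨n, hocc L n hn, h⟩
  · have h1 := hG (N + 1)
    have h2 := h1
    rw [← hp.1, Ultrafilter.mem_add_iff] at h2
    obtain ⟨h, hh1, hh2⟩ := (h2.and h1).exists
    refine ⟨h, fun n hn hnN => ?_⟩
    have e1 := hh2 (n - h) (by omega)
    have e2 := hocc _ h hh1 (n - h) (by omega)
    rw [← Nat.add_sub_assoc hn.le, Nat.add_sub_cancel_left] at e1 e2
    rw [Set.mem_ofPred_eq, e2, ← e1]
    exact ⟨fun h => ⟨n, h, rfl⟩, fun ⟨a, ha, h⟩ => mem_of_coe_eq h ha⟩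

theorem DynCentralSyndetic.mono {A B : Set ℕ+} (hA : DynCentralSyndetic A) (h : A ⊆ B) :
    DynCentralSyndetic B := by
  obtain ⟨S, x, U, hU, hx, hsub⟩ := hA
  exact ⟨S, x, U, hU, hx, hsub.trans h⟩

theorem eq_union_inter_union_compl (A B : Set ℕ+) : A = (A ∪ B) ∩ (A ∪ Bᶜ) := by
  rw [← Set.union_inter_distrib_left, Set.inter_compl_self, Set.union_empty]

theorem Thick.union_compl {A B : Set ℕ+} (h : Thick {n | n ∈ A ↔ n ∈ B}) : Thick (A ∪ Bᶜ) :=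
  h.mono fun n hn => (em (n ∈ B)).imp hn.2 id

theorem Central.dynCentralPS {A : Set ℕ+} (hA : Central A) : DynCentralPS A := by
  obtain ⟨p, hp, hAp⟩ := hA.exists_isMinimalIdempotent
  obtain ⟨Z, hZ, h0, hthick⟩ := hp.exists_uniformlyRecurrent hAp
  exact ⟨_, _, (hZ.dynCentralSyndetic h0).mono Set.subset_union_right,
    hthick.union_compl.pointwiseRecurrent, eq_union_inter_union_compl A {n | (n : ℕ) ∈ Z}⟩

theorem dynPS_of_thick_iff {A : Set ℕ+} (S : MinSystem) (y : S.X) {U : Set S.X} (hU : IsOpen U)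
    (hne : U.Nonempty) (h : Thick {n : ℕ+ | n ∈ A ↔ n ∈ retTimes S.T y U}) : DynPS A :=
  ⟨_, _, ⟨S, y, U, hU, hne, Set.subset_union_right⟩, h.union_compl.dynThick,
    eq_union_inter_union_compl A (retTimes S.T y U)⟩

theorem PiecewiseSyndetic.dynPS {A : Set ℕ+} (hA : PiecewiseSyndetic A) : DynPS A := by
  obtain ⟨N, hN⟩ := hA
  obtain ⟨p, hp, hHp⟩ := hN.exists_isMinimalIdempotent
  obtain ⟨k, hk⟩ : ∃ k : ℕ, {m : ℕ+ | ∃ a ∈ A, (a : ℕ) = m + k} ∈ p := by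
    rcases Ultrafilter.union_mem_iff.1 hHp with h | h
    · exact ⟨0, Filter.mem_of_superset h fun a ha => ⟨a, ha, rfl⟩⟩
    · obtain ⟨k, -, hk⟩ := (Ultrafilter.finite_biUnion_mem_iff (Set.finite_Iic N)).1 h
      exact ⟨k, Filter.mem_of_superset hk fun a ha => ⟨_, ha, rfl⟩⟩
  obtain ⟨Z, hZ, h0, hthick⟩ := hp.exists_uniformlyRecurrent hk
  obtain ⟨S, x, U, hU, hxU⟩ := hZ.exists_minSystem
  obtain ⟨y, rfl⟩ := S.surjective.iterate k x
  refine dynPS_of_thick_iff S y hU ⟨_, (hxU 0).2 h0⟩ (thick_of_forall_interval fun M => ?_)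
  obtain ⟨h, hh⟩ := hthick.exists_interval M
  refine ⟨h + k, fun n hn hnM => ?_⟩
  obtain ⟨m, hm⟩ := exists_pnat_eq (n := n - k) (by omega)
  have hmn : (n : ℕ) = m + k := by omega
  have hiff := hh m (by rw [← PNat.coe_le_coe]; omega) (by omega)
  rw [Set.mem_ofPred_eq, ← hxU, ← Function.iterate_add_apply, ← hmn] at hiff
  rw [Set.mem_ofPred_eq]
  exact Iff.trans ⟨fun ha => ⟨n, ha, hmn⟩,
    fun ⟨a, ha, h⟩ => mem_of_coe_eq (h.trans hmn.symm) ha⟩ hiff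

/-- The integers in `[m ^ 2, m ^ 2 + m]` whose `2`-adic valuation is the label
`(Nat.unpair m).1` of this interval. -/
def labelledBlocks : Set ℕ+ :=
  {h | ∃ m : ℕ, m ^ 2 ≤ h ∧ (h : ℕ) ≤ m ^ 2 + m ∧
    2 ^ (Nat.unpair m).1 ∣ (h : ℕ) ∧ ¬ 2 ^ ((Nat.unpair m).1 + 1) ∣ (h : ℕ)}

theorem pointwiseRecurrent_labelledBlocks : PointwiseRecurrent labelledBlocks := by
  intro S x U hU hx
  obtain ⟨_, hg⟩ := S.exists_return hU ⟨x, hx⟩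
  obtain ⟨n, hn, hn0, -⟩ := hg x 0
  obtain ⟨a, b, hb, hnab⟩ := Nat.exists_eq_two_pow_mul_odd (n := n) (by omega)
  obtain ⟨g, hg⟩ := S.boundedGaps_dvd (hU.preimage (S.cont.iterate n)) hn
    (k := 2 ^ (a + 1)) (by positivity)
  have hm := Nat.right_le_pair a (g + n)
  obtain ⟨s, ⟨hs, hdvd⟩, h1, h2⟩ := hg (Nat.pair a (g + n) ^ 2)
  obtain ⟨h, hh⟩ := exists_pnat_eq (n := s + n) (by omega)
  refine ⟨h, ⟨Nat.pair a (g + n), by omega, by omega, ?_, ?_⟩, ?_⟩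
  · rw [Nat.unpair_pair, hh]
    exact dvd_add ((pow_dvd_pow 2 a.le_succ).trans hdvd) ⟨b, hnab⟩
  · rw [Nat.unpair_pair, hh, Nat.dvd_add_right hdvd, hnab, pow_succ,
      Nat.mul_dvd_mul_iff_left (by positivity)]
    exact hb.not_two_dvd_nat
  · rw [hh, add_comm, Function.iterate_add_apply]
    exact hs

theorem not_central_labelledBlocks : ¬ Central labelledBlocks := by
  intro hC
  obtain ⟨p, ⟨hid, -⟩, hp⟩ := hC.exists_isMinimalIdempotent
  have hpp := hp
  rw [← hid, Ultrafilter.mem_add_iff] at hpp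
  obtain ⟨n, hn⟩ := hpp.exists
  obtain ⟨h, hh, hhn, hlt, hdvd⟩ := (Filter.Eventually.and hp (Filter.Eventually.and hn
    ((eventually_gt_of_idempotent hid ((n + 2) ^ 2)).and
      (eventually_dvd_of_idempotent hid (k := 2 ^ (n : ℕ)) (by positivity))))).exists
  obtain ⟨m, h1, h2, h3, h4⟩ := hh
  obtain ⟨m', h1', h2', h3', -⟩ := hhn
  rw [PNat.add_coe] at h1' h2' h3'
  have hm : (n : ℕ) + 2 ≤ m := by
    by_contra! hlt'
    nlinarith
  obtain rfl : m' = m := by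
    rcases lt_trichotomy m' m with hlt' | h | hlt'
    · nlinarith
    · exact h
    · nlinarith
  have hle : (n : ℕ) ≤ (Nat.unpair m').1 := by
    by_contra! hlt'
    exact h4 ((pow_dvd_pow 2 hlt').trans hdvd)
  have hn2 := (pow_dvd_pow 2 hle).trans ((Nat.dvd_add_right h3).1 h3')
  exact (Nat.lt_two_pow_self (n := n)).not_ge (Nat.le_of_dvd n.pos hn2)

theorem dynCentralPS_labelledBlocks : DynCentralPS labelledBlocks := by
  have huniv : UniformlyRecurrent Set.univ := fun L =>
    ⟨0, fun a => ⟨a, fun _ _ => Iff.rfl, le_rfl, le_rfl⟩⟩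
  exact ⟨Set.univ, _, (huniv.dynCentralSyndetic (Set.mem_univ 0)).mono (Set.subset_univ _),
    pointwiseRecurrent_labelledBlocks, (Set.univ_inter _).symm⟩

theorem piecewiseSyndetic_odd : PiecewiseSyndetic {n : ℕ+ | ¬ 2 ∣ (n : ℕ)} := by
  refine ⟨1, fun _ => ⟨1, fun f _ => ?_⟩⟩
  by_cases h : 2 ∣ ((f + 1 : ℕ+) : ℕ)
  · refine Or.inr (Set.mem_biUnion (x := 1) (show (1 : ℕ+) ≤ 1 from le_rfl) ?_)
    show ¬ 2 ∣ ((f + 1 + 1 : ℕ+) : ℕ)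
    rw [PNat.add_coe _ 1, PNat.one_coe]
    omega
  · exact Or.inl h

theorem not_dynCentralPS_odd : ¬ DynCentralPS {n : ℕ+ | ¬ 2 ∣ (n : ℕ)} := by
  rintro ⟨B, C, ⟨S, x, U, hU, hx, hB⟩, hC, hBC⟩
  obtain ⟨Z, hZ, h0, hrec⟩ := exists_uniformlyRecurrent_subset (n₀ := 0)
    (A := {s : ℕ | S.T^[s] x ∈ U ∧ 2 ∣ s}) (by
      intro F hF hFA
      obtain ⟨g, hg⟩ := S.boundedGaps_dvd (S.isOpen_biInter hU hF)
        (Set.mem_iInter₂.2 fun f hf => (hFA hf).1) two_pos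
      refine ⟨g, fun a => ?_⟩
      obtain ⟨s, ⟨hs1, hs2⟩, h⟩ := hg a
      refine ⟨s, fun f hf => ⟨?_, dvd_add hs2 (hFA hf).2⟩, h⟩
      rw [add_comm, Function.iterate_add_apply]
      exact Set.mem_iInter₂.1 hs1 f hf) ⟨hx, dvd_zero 2⟩
  obtain ⟨S', y, V, hV, hy⟩ := hrec.exists_minSystem
  obtain ⟨c, hc, hcV⟩ := hC S' y V hV ((hy 0).2 h0)
  obtain ⟨h1, h2⟩ := hZ ((hy c).1 hcV)
  exact (Set.ext_iff.1 hBC c).2 ⟨hB h1, hc⟩ h2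

/-- **Theorem F.** `𝒞 ⊊ dc𝒫𝒮 ⊊ d𝒫𝒮 = 𝒫𝒮`: the central sets are properly contained in the
dynamically central piecewise syndetic sets, which are properly contained in the dynamically
piecewise syndetic sets, and the latter coincide with the piecewise syndetic sets. -/
theorem central_dcPS_dPS_PS :
    {A : Set ℕ+ | Central A} ⊂ {A : Set ℕ+ | DynCentralPS A} ∧
    {A : Set ℕ+ | DynCentralPS A} ⊂ {A : Set ℕ+ | DynPS A} ∧
    {A : Set ℕ+ | DynPS A} = {A : Set ℕ+ | PiecewiseSyndetic A} := by
  refine ⟨⟨fun A hA => hA.dynCentralPS, fun h => ?_⟩,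
    ⟨fun A hA => hA.piecewiseSyndetic.dynPS, fun h => ?_⟩,
    Set.ext fun A => ⟨fun hA => hA.piecewiseSyndetic, fun hA => hA.dynPS⟩⟩
  · exact not_central_labelledBlocks (h dynCentralPS_labelledBlocks)
  · exact not_dynCentralPS_odd (h piecewiseSyndetic_odd.dynPS)
end

section
/- Neither the family of dynamically syndetic subsets of ℕ nor the family of dynamically central syndetic subsets of ℕ is σ-compact. -/
open Set

/-- The dual of a family: all sets meeting every member of the family. -/
def dualFam (F : Set (Set ℕ+)) : Set (Set ℕ+) :=
  {B : Set ℕ+ | ∀ A ∈ F, (B ∩ A).Nonempty}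

/-- A family `𝔉` is compact if for every `B ∈ 𝔉*` there is `M` with
`B ∩ {1, …, M} ∈ 𝔉*`. -/
def CompactFamily (F : Set (Set ℕ+)) : Prop :=
  ∀ B ∈ dualFam F, ∃ M : ℕ+, (B ∩ {m : ℕ+ | m ≤ M}) ∈ dualFam F

/-- A family is σ-compact if it is the union of countably many compact families. -/
def SigmaCompactFamily (F : Set (Set ℕ+)) : Prop :=
  ∃ G : ℕ → Set (Set ℕ+),
    (∀ n, UpwardClosed (G n) ∧ CompactFamily (G n)) ∧ F = ⋃ n, G n

/-- Starting position of the `k`-th block in the concatenation of the blocks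
`u^(j+1) v`, where `u` has length `l` and `v` has length `l + 1`. -/
def blockStart (l : ℕ) : ℕ → ℕ
  | 0 => 0
  | k + 1 => blockStart l k + (k + 1) * l + (l + 1)

lemma blockStart_cast (l k : ℕ) : (blockStart l k : ZMod l) = k := by
  induction k with
  | zero => simp [blockStart]
  | succ k ih => simp [blockStart, ih]

lemma le_blockStart (l k : ℕ) : k ≤ blockStart l k := by
  induction k with
  | zero => simp
  | succ k ih => rw [blockStart]; omega

/-- A dynamically thick set which, on long blocks, is contained in one residue class modulo `l`. -/
def blockSet (l : ℕ) : Set ℕ+ :=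
  {n : ℕ+ | ∃ k j : ℕ, j ≤ k ∧ (n : ℕ) = blockStart l k + j * l + 1}

/-- Residues modulo `l` of the visiting times of `x` to `U`. -/
def visitResidues {X : Type} (l : ℕ) (T : X → X) (U : Set X) (x : X) : Set (ZMod l) :=
  {r | ∃ n : ℕ, (n : ZMod l) = r ∧ T^[n] x ∈ U}

/-- All visit residues of `x` are attained, within a common time bound, by points near `x`. -/
lemma visitResidues_eventually {X : Type} [TopologicalSpace X] (l : ℕ) [NeZero l] {T : X → X}
    (hT : Continuous T) {U : Set X} (hU : IsOpen U) (x : X) :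
    ∃ N : ℕ, ∀ᶠ y in nhds x, ∀ r ∈ visitResidues l T U x,
      ∃ n ≤ N, (n : ZMod l) = r ∧ T^[n] y ∈ U := by
  have h : ∀ r : ZMod l, ∃ n : ℕ, r ∈ visitResidues l T U x → (n : ZMod l) = r ∧ T^[n] x ∈ U := by
    intro r
    by_cases hr : r ∈ visitResidues l T U x
    · obtain ⟨n, hn⟩ := hr
      exact ⟨n, fun _ => hn⟩
    · exact ⟨0, fun h => absurd h hr⟩
  choose f hf using h
  refine ⟨Finset.univ.sup f, ?_⟩
  rw [Filter.eventually_all]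
  intro r
  by_cases hr : r ∈ visitResidues l T U x
  · filter_upwards [(hU.preimage (hT.iterate (f r))).mem_nhds (hf r hr).2] with y hy _
    exact ⟨f r, Finset.le_sup (Finset.mem_univ r), (hf r hr).1, hy⟩
  · exact Filter.Eventually.of_forall fun y h => absurd h hr

lemma image_add_visitResidues_iterate_subset {X : Type} (l : ℕ) [NeZero l] (T : X → X) (U : Set X)
    (x : X) (t : ℕ) : (fun r => r + (t : ZMod l)) '' visitResidues l T U (T^[t] x) ⊆
      visitResidues l T U x := by
  rintro _ ⟨r, ⟨n, rfl, hn⟩, rfl⟩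
  exact ⟨n + t, by simp, by rwa [Function.iterate_add_apply]⟩

lemma visitResidues_ncard_eq (S : MinSystem) (l : ℕ) [NeZero l] {U : Set S.X} (hU : IsOpen U)
    (x y : S.X) : (visitResidues l S.T U x).ncard = (visitResidues l S.T U y).ncard := by
  suffices h : ∀ x y : S.X,
      (visitResidues l S.T U x).ncard ≤ (visitResidues l S.T U y).ncard from
    le_antisymm (h x y) (h y x)
  intro x y
  obtain ⟨N, hN⟩ := visitResidues_eventually l S.cont hU x
  obtain ⟨_, hz, n, rfl⟩ := mem_closure_iff_nhds.1 (S.minimal y x) _ hN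
  have hsub : visitResidues l S.T U x ⊆ visitResidues l S.T U (S.T^[(n : ℕ)] y) := by
    intro r hr
    obtain ⟨m, -, hm⟩ := hz r hr
    exact ⟨m, hm⟩
  calc _ ≤ (visitResidues l S.T U (S.T^[(n : ℕ)] y)).ncard := ncard_le_ncard hsub (toFinite _)
    _ = ((fun r => r + ((n : ℕ) : ZMod l)) '' visitResidues l S.T U (S.T^[(n : ℕ)] y)).ncard :=
      (ncard_image_of_injective _ (add_left_injective _)).symm
    _ ≤ _ := ncard_le_ncard (image_add_visitResidues_iterate_subset l S.T U y n) (toFinite _)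

/-- In a minimal system the residues of visiting times are translated along orbits. -/
lemma sub_mem_visitResidues_iterate (S : MinSystem) (l : ℕ) [NeZero l] {U : Set S.X}
    (hU : IsOpen U) (x : S.X) (t : ℕ) {r : ZMod l} (hr : r ∈ visitResidues l S.T U x) :
    r - t ∈ visitResidues l S.T U (S.T^[t] x) := by
  have h := Set.eq_of_subset_of_ncard_le (image_add_visitResidues_iterate_subset l S.T U x t)
    (by rw [ncard_image_of_injective _ (add_left_injective _)]
        exact (visitResidues_ncard_eq S l hU _ _).le) (toFinite _)
  rw [← h] at hr
  obtain ⟨q, hq, rfl⟩ := hr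
  simpa using hq

lemma exists_uniform_visit_bound (S : MinSystem) (l : ℕ) [NeZero l] {U : Set S.X}
    (hU : IsOpen U) : ∃ N : ℕ, ∀ x, ∀ r ∈ visitResidues l S.T U x,
      ∃ n ≤ N, (n : ZMod l) = r ∧ S.T^[n] x ∈ U := by
  choose N hN using fun x => visitResidues_eventually l S.cont hU x
  obtain ⟨s, -, hs⟩ := isCompact_univ.elim_nhds_subcover _ fun x _ => hN x
  refine ⟨s.sup N, fun y r hr => ?_⟩
  obtain ⟨x, hx, hy⟩ := mem_iUnion₂.1 (hs (mem_univ y))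
  have hsub : visitResidues l S.T U x ⊆ visitResidues l S.T U y := by
    intro q hq
    obtain ⟨m, -, hm⟩ := hy q hq
    exact ⟨m, hm⟩
  rw [← Set.eq_of_subset_of_ncard_le hsub (visitResidues_ncard_eq S l hU y x).le (toFinite _)] at hr
  obtain ⟨n, hn, h⟩ := hy r hr
  exact ⟨n, hn.trans (Finset.le_sup hx), h⟩

lemma blockSet_mem_dualFam (l : ℕ) [NeZero l] : blockSet l ∈ dualFam {A | DynSyndetic A} := by
  rintro A ⟨S, x, U, hU, ⟨u, hu⟩, hA⟩
  obtain ⟨N, hN⟩ := exists_uniform_visit_bound S l hU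
  obtain ⟨_, hn, n, rfl⟩ := mem_closure_iff.1 (S.minimal x u) U hU hu
  have hr : ((n : ℕ) : ZMod l) ∈ visitResidues l S.T U x := ⟨n, rfl, hn⟩
  set ρ : ZMod l := ((n : ℕ) : ZMod l)
  set k := (ρ - 1).val + l * N
  have hk : (k : ZMod l) = ρ - 1 := by simp [k]
  have hNk : N ≤ k := (Nat.le_mul_of_pos_left N (NeZero.pos l)).trans (Nat.le_add_left _ _)
  have h0 := sub_mem_visitResidues_iterate S l hU x (blockStart l k + 1) hr
  have : ρ - ((blockStart l k + 1 : ℕ) : ZMod l) = 0 := by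
    push_cast
    rw [blockStart_cast, hk]
    ring
  rw [this] at h0
  obtain ⟨m, hm, hm0, hmU⟩ := hN _ 0 h0
  obtain ⟨j, rfl⟩ := (ZMod.natCast_eq_zero_iff m l).1 hm0
  have hj : j ≤ k := ((Nat.le_mul_of_pos_left j (NeZero.pos l)).trans hm).trans hNk
  refine ⟨⟨blockStart l k + j * l + 1, Nat.succ_pos _⟩, ⟨k, j, hj, rfl⟩, hA ?_⟩
  rw [← Function.iterate_add_apply] at hmU
  have e : l * j + (blockStart l k + 1) = blockStart l k + j * l + 1 := by ring
  rw [e] at hmU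
  exact hmU

lemma DynCentralSyndetic.dynSyndetic {A : Set ℕ+} (h : DynCentralSyndetic A) : DynSyndetic A := by
  obtain ⟨S, x, U, hU, hx, hA⟩ := h
  exact ⟨S, x, U, hU, ⟨x, hx⟩, hA⟩

/-- The left shift on one-sided binary sequences. -/
def leftShift (x : ℕ → Bool) : ℕ → Bool := fun n => x (n + 1)

lemma leftShift_iterate (n : ℕ) (x : ℕ → Bool) (i : ℕ) : leftShift^[n] x i = x (i + n) := by
  induction n generalizing x with
  | zero => rfl
  | succ n ih => rw [Function.iterate_succ_apply, ih]; rfl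

lemma continuous_leftShift : Continuous leftShift :=
  continuous_pi fun n => continuous_apply (n + 1)

lemma eventually_agree (x : ℕ → Bool) (m : ℕ) : ∀ᶠ y in nhds x, ∀ i < m, y i = x i := by
  refine (Set.finite_lt_nat m).eventually_all.2 fun i _ => ?_
  exact (continuous_apply i).continuousAt.eventually_mem ((isOpen_discrete {x i}).mem_nhds rfl)

lemma exists_agree_subset {x : ℕ → Bool} {s : Set (ℕ → Bool)} (hs : s ∈ nhds x) :
    ∃ m : ℕ, ∀ y : ℕ → Bool, (∀ i < m, y i = x i) → y ∈ s := by
  rw [nhds_pi, Filter.mem_pi] at hs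
  obtain ⟨I, hI, t, ht, hts⟩ := hs
  obtain ⟨m, hm⟩ := hI.bddAbove
  refine ⟨m + 1, fun y hy => hts fun i hi => ?_⟩
  rw [hy i (Nat.lt_succ_of_le (hm hi))]
  exact mem_of_mem_nhds (ht i)

/-- Prefixes of `x` occur with bounded gaps. -/
def PrefixRecurrent (x : ℕ → Bool) : Prop :=
  ∀ m : ℕ, ∃ L : ℕ, ∀ i : ℕ, ∃ d ≤ L, ∀ j < m, x (i + d + j) = x j

lemma PrefixRecurrent.mem_closure {x y : ℕ → Bool} (hx : PrefixRecurrent x)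
    (hy : y ∈ closure (range fun n : ℕ => leftShift^[n] x)) :
    x ∈ closure (range fun n : ℕ+ => leftShift^[(n : ℕ)] y) := by
  rw [mem_closure_iff_nhds]
  intro s hs
  obtain ⟨m, hm⟩ := exists_agree_subset hs
  obtain ⟨L, hL⟩ := hx m
  obtain ⟨_, hz, n, rfl⟩ := mem_closure_iff_nhds.1 hy _ (eventually_agree y (L + m + 1))
  obtain ⟨d, hd, h⟩ := hL (n + 1)
  refine ⟨_, hm _ fun j hj => ?_, ⟨⟨d + 1, Nat.succ_pos _⟩, rfl⟩⟩
  simp only [PNat.mk_coe]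
  rw [leftShift_iterate, ← h j hj]
  have := hz (j + (d + 1)) (by omega)
  refine this.symm.trans ((leftShift_iterate n x _).trans ?_)
  congr 1
  omega

lemma leftShift_mem_orbitClosure {x y : ℕ → Bool}
    (hy : y ∈ closure (range fun n : ℕ => leftShift^[n] x)) :
    leftShift y ∈ closure (range fun n : ℕ => leftShift^[n] x) := by
  refine map_mem_closure continuous_leftShift hy ?_
  rintro _ ⟨n, rfl⟩
  exact ⟨n + 1, Function.iterate_succ_apply' _ _ _⟩

lemma PrefixRecurrent.dynCentralSyndetic {x : ℕ → Bool} (hx : PrefixRecurrent x)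
    (h0 : x 0 = true) : DynCentralSyndetic {n : ℕ+ | x n = true} := by
  let Y : Set (ℕ → Bool) := closure (range fun n : ℕ => leftShift^[n] x)
  have hxY : x ∈ Y := subset_closure ⟨0, rfl⟩
  let T : Y → Y := fun y => ⟨leftShift y, leftShift_mem_orbitClosure y.2⟩
  have hT : Continuous T := (continuous_leftShift.comp continuous_subtype_val).subtype_mk _
  have hTn : ∀ (n : ℕ) (y : Y), (T^[n] y : ℕ → Bool) = leftShift^[n] y := by
    intro n
    induction n with
    | zero => intro y; rfl
    | succ n ih => intro y; rw [Function.iterate_succ_apply, ih]; rfl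
  have hU : IsOpen {y : Y | (y : ℕ → Bool) 0 = true} := (isOpen_discrete {true}).preimage
    ((continuous_apply (A := fun _ : ℕ => Bool) 0).comp continuous_subtype_val)
  let : MetricSpace Y := TopologicalSpace.metrizableSpaceMetric Y
  have : CompactSpace Y := isCompact_iff_compactSpace.1 isClosed_closure.isCompact
  have : Nonempty Y := ⟨⟨x, hxY⟩⟩
  have hmin : MinimalMap T := by
    intro y
    set D := range fun n : ℕ+ => T^[(n : ℕ)] y
    have hinv : ∀ z ∈ closure D, T z ∈ closure D := by
      intro z hz
      refine map_mem_closure hT hz ?_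
      rintro _ ⟨n, rfl⟩
      exact ⟨n + 1, Function.iterate_succ_apply' _ _ _⟩
    have hxD : (⟨x, hxY⟩ : Y) ∈ closure D := by
      rw [closure_subtype]
      convert hx.mem_closure y.2 using 2
      ext z
      simp only [D, mem_image, mem_range, exists_exists_eq_and, hTn]
    have horb : ∀ n : ℕ, T^[n] ⟨x, hxY⟩ ∈ closure D := by
      intro n
      induction n with
      | zero => exact hxD
      | succ n ih => rw [Function.iterate_succ_apply']; exact hinv _ ih
    intro z
    rw [← isClosed_closure.closure_eq (s := closure D), closure_subtype]
    refine closure_mono ?_ z.2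
    rintro _ ⟨n, rfl⟩
    exact ⟨_, horb n, hTn _ _⟩
  refine ⟨⟨Y, T, hT, hmin⟩, ⟨x, hxY⟩, {y : Y | (y : ℕ → Bool) 0 = true}, hU, h0, ?_⟩
  intro n hn
  have h : (T^[(n : ℕ)] ⟨x, hxY⟩ : Y).1 0 = true := hn
  rwa [hTn, leftShift_iterate, Nat.zero_add] at h

/-- Words that are concatenations of copies of `u` and `v`. -/
inductive Concat (u v : List Bool) : List Bool → Prop
  | nil : Concat u v []
  | cons {s w : List Bool} : s = u ∨ s = v → Concat u v w → Concat u v (s ++ w)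

namespace Concat

variable {u v w w' p : List Bool}

lemma left : Concat u v u := by simpa using cons (Or.inl rfl) (nil (u := u) (v := v))

lemma right : Concat u v v := by simpa using cons (Or.inr rfl) (nil (u := u) (v := v))

lemma append (h : Concat u v w) (h' : Concat u v w') : Concat u v (w ++ w') := by
  induction h with
  | nil => exact h'
  | cons hs _ ih => rw [List.append_assoc]; exact cons hs ih

lemma replicate (n : ℕ) : Concat u v (List.replicate n u).flatten := by
  induction n with
  | zero => exact nil
  | succ n ih => exact cons (Or.inl rfl) ih

lemma trans {u' v' : List Bool} (h : Concat u' v' w) (hu : Concat u v u') (hv : Concat u v v') :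
    Concat u v w := by
  induction h with
  | nil => exact nil
  | cons hs _ ih =>
    rcases hs with rfl | rfl
    · exact hu.append ih
    · exact hv.append ih

lemma prefix_of_ne_nil (h : Concat u v w) (hu : p <+: u) (hv : p <+: v) (hw : w ≠ []) :
    p <+: w := by
  cases h with
  | nil => exact absurd rfl hw
  | cons hs _ =>
    rcases hs with rfl | rfl
    · exact hu.trans (List.prefix_append _ _)
    · exact hv.trans (List.prefix_append _ _)

lemma exists_prefix_drop (h : Concat u v w) (hu : p <+: u) (hv : p <+: v) {L : ℕ}
    (huL : u.length ≤ L) (hvL : v.length ≤ L) :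
    ∀ i, i + L < w.length → ∃ d ≤ L, p <+: w.drop (i + d) := by
  induction h with
  | nil => intro i hi; simp at hi
  | @cons s w hs hw ih =>
    intro i hi
    have hsL : s.length ≤ L := by rcases hs with rfl | rfl <;> assumption
    rw [List.length_append] at hi
    rcases le_total i s.length with his | his
    · refine ⟨s.length - i, by omega, ?_⟩
      rw [Nat.add_sub_cancel' his, List.drop_left]
      refine hw.prefix_of_ne_nil hu hv (List.ne_nil_of_length_pos (by omega))
    · obtain ⟨d, hd, hp⟩ := ih (i - s.length) (by omega)
      refine ⟨d, hd, ?_⟩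
      rw [List.drop_append, List.drop_eq_nil_of_le (by omega), List.nil_append]
      convert hp using 2
      omega

end Concat

/-- The word `(u v) (u u v) ⋯ (u^K v)`. -/
def blockWord (u v : List Bool) : ℕ → List Bool
  | 0 => []
  | K + 1 => blockWord u v K ++ ((List.replicate (K + 1) u).flatten ++ v)

lemma blockWord_length {u v : List Bool} (h : v.length = u.length + 1) (K : ℕ) :
    (blockWord u v K).length = blockStart u.length K := by
  induction K with
  | zero => rfl
  | succ K ih =>
    rw [blockWord, blockStart, List.length_append, List.length_append, ih, h]
    simp [add_assoc]

lemma blockWord_concat (u v : List Bool) (K : ℕ) : Concat u v (blockWord u v K) := by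
  induction K with
  | zero => exact Concat.nil
  | succ K ih => exact ih.append ((Concat.replicate _).append Concat.right)

lemma prefix_blockWord (u v : List Bool) {K : ℕ} (hK : 0 < K) : u <+: blockWord u v K := by
  induction K, hK using Nat.le_induction with
  | base => simp [blockWord]
  | succ K _ ih => exact ih.trans (List.prefix_append _ _)

lemma replicate_flatten_getElem? {u : List Bool} {i : ℕ} {c : Bool} (hi : u[i]? = some c)
    {n j : ℕ} (hj : j < n) : (List.replicate n u).flatten[j * u.length + i]? = some c := by
  have hlt : i < u.length := (List.getElem?_eq_some_iff.1 hi).1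
  induction n generalizing j with
  | zero => omega
  | succ n ih =>
    rw [List.replicate_succ, List.flatten_cons]
    cases j with
    | zero => rw [Nat.zero_mul, Nat.zero_add, List.getElem?_append_left hlt, hi]
    | succ j =>
      rw [List.getElem?_append_right (by rw [Nat.succ_mul]; omega), ← ih (j := j) (by omega)]
      congr 1
      rw [Nat.succ_mul]
      omega

lemma blockWord_getElem? {u v : List Bool} (h : v.length = u.length + 1) {c : Bool}
    (hc : u[1]? = some c) {K k j : ℕ} (hk : k < K) (hj : j ≤ k) :
    (blockWord u v K)[blockStart u.length k + j * u.length + 1]? = some c := by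
  induction K with
  | zero => omega
  | succ K ih =>
    rw [blockWord]
    rcases Nat.lt_succ_iff_lt_or_eq.1 hk with hk | rfl
    · have := ih hk
      rwa [List.getElem?_append_left (List.getElem?_eq_some_iff.1 this).1]
    · have := replicate_flatten_getElem? hc (Nat.lt_succ_of_le hj)
      rw [List.getElem?_append_right (by rw [blockWord_length h]; omega), blockWord_length h,
        add_assoc, Nat.add_sub_cancel_left,
        List.getElem?_append_left (List.getElem?_eq_some_iff.1 this).1, this]

lemma getElem?_eq_of_isPrefixOf {u v : List Bool} (h : u <+: v) {i : ℕ} {c : Bool}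
    (hc : u[i]? = some c) : v[i]? = some c := by
  obtain ⟨hi, rfl⟩ := List.getElem?_eq_some_iff.1 hc
  exact List.prefix_iff_getElem?.1 h i hi

/-- The successive pairs of words used to build the recurrent sequence, where `K` prescribes
the number of blocks in terms of the stage and of the current word length. -/
def wordPair (K : ℕ → ℕ → ℕ) : ℕ → List Bool × List Bool
  | 0 => ([true, false], [true, false, false])
  | n + 1 =>
    let w := wordPair K n
    (blockWord w.1 w.2 (K n w.1.length) ++ w.1, blockWord w.1 w.2 (K n w.1.length) ++ w.2)

section WordPair

variable {K : ℕ → ℕ → ℕ}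

lemma wordPair_length_snd (n : ℕ) :
    (wordPair K n).2.length = (wordPair K n).1.length + 1 := by
  induction n with
  | zero => rfl
  | succ n ih => simp [wordPair, ih, add_assoc]

lemma prefix_wordPair_succ (hK : ∀ n l, 0 < K n l) (n : ℕ) :
    (wordPair K n).1 <+: (wordPair K (n + 1)).1 ∧ (wordPair K n).1 <+: (wordPair K (n + 1)).2 :=
  ⟨(prefix_blockWord _ _ (hK n _)).trans (List.prefix_append _ _),
    (prefix_blockWord _ _ (hK n _)).trans (List.prefix_append _ _)⟩

lemma prefix_wordPair (hK : ∀ n l, 0 < K n l) {m n : ℕ} (h : m ≤ n) :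
    (wordPair K m).1 <+: (wordPair K n).1 := by
  induction n, h using Nat.le_induction with
  | base => exact List.prefix_rfl
  | succ n _ ih => exact ih.trans (prefix_wordPair_succ hK n).1

lemma lt_wordPair_length (hK : ∀ n l, 0 < K n l) (n : ℕ) : n < (wordPair K n).1.length := by
  induction n with
  | zero => simp [wordPair]
  | succ n ih =>
    have := (le_blockStart (wordPair K n).1.length (K n (wordPair K n).1.length))
    have := hK n (wordPair K n).1.length
    simp only [wordPair, List.length_append, blockWord_length (wordPair_length_snd n)]
    omega

lemma wordPair_concat {m n : ℕ} (h : m ≤ n) :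
    Concat (wordPair K m).1 (wordPair K m).2 (wordPair K n).1 ∧
      Concat (wordPair K m).1 (wordPair K m).2 (wordPair K n).2 := by
  induction n, h using Nat.le_induction with
  | base => exact ⟨Concat.left, Concat.right⟩
  | succ n _ ih =>
    have hw := (blockWord_concat (wordPair K n).1 (wordPair K n).2
      (K n (wordPair K n).1.length)).trans ih.1 ih.2
    exact ⟨hw.append ih.1, hw.append ih.2⟩

/-- The limit of the words `(wordPair K n).1`. -/
def limitSeq (K : ℕ → ℕ → ℕ) (i : ℕ) : Bool := ((wordPair K i).1[i]?).getD false

lemma limitSeq_eq_of_getElem? (hK : ∀ n l, 0 < K n l) {n i : ℕ} {c : Bool}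
    (h : (wordPair K n).1[i]? = some c) : limitSeq K i = c := by
  have hi := List.getElem?_eq_getElem (lt_wordPair_length hK i)
  have hn := getElem?_eq_of_isPrefixOf (prefix_wordPair hK (le_max_left n i)) h
  rw [getElem?_eq_of_isPrefixOf (prefix_wordPair hK (le_max_right n i)) hi, Option.some_inj] at hn
  rw [limitSeq, hi, Option.getD_some, hn]

lemma getElem?_wordPair (hK : ∀ n l, 0 < K n l) {n i : ℕ} (h : i < (wordPair K n).1.length) :
    (wordPair K n).1[i]? = some (limitSeq K i) := by
  rw [limitSeq_eq_of_getElem? hK (List.getElem?_eq_getElem h), List.getElem?_eq_getElem h]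

lemma limitSeq_zero (hK : ∀ n l, 0 < K n l) : limitSeq K 0 = true :=
  limitSeq_eq_of_getElem? hK (n := 0) rfl

lemma limitSeq_prefixRecurrent (hK : ∀ n l, 0 < K n l) : PrefixRecurrent (limitSeq K) := by
  intro m
  have hl := wordPair_length_snd (K := K) (m + 1)
  refine ⟨(wordPair K (m + 1)).2.length, fun i => ?_⟩
  set L := (wordPair K (m + 1)).2.length
  obtain ⟨d, hd, hp⟩ := (wordPair_concat (K := K) (le_max_left (m + 1) (i + L))).1.exists_prefix_drop
    (prefix_wordPair_succ hK m).1 (prefix_wordPair_succ hK m).2 (L := L) (by omega) le_rfl i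
    ((le_max_right _ _).trans_lt (lt_wordPair_length hK _))
  refine ⟨d, hd, fun j hj => ?_⟩
  have h := getElem?_wordPair hK (hj.trans (lt_wordPair_length hK m))
  have hd := getElem?_eq_of_isPrefixOf hp h
  rw [List.getElem?_drop] at hd
  exact limitSeq_eq_of_getElem? hK hd

lemma limitSeq_eq_false (hK : ∀ n l, 0 < K n l) (n : ℕ) {k j : ℕ}
    (hk : k < K n (wordPair K n).1.length) (hj : j ≤ k) :
    limitSeq K (blockStart (wordPair K n).1.length k + j * (wordPair K n).1.length + 1) = false := by
  have h1 : (wordPair K n).1[1]? = some false := by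
    obtain ⟨t, ht⟩ := prefix_wordPair hK (Nat.zero_le n)
    rw [← ht]
    rfl
  have h := blockWord_getElem? (wordPair_length_snd n) h1 hk hj
  refine limitSeq_eq_of_getElem? hK (n := n + 1) ?_
  rw [wordPair, List.getElem?_append_left (List.getElem?_eq_some_iff.1 h).1, h]

end WordPair

lemma exists_dynCentralSyndetic_notMem {G : ℕ → Set (Set ℕ+)} (hc : ∀ n, CompactFamily (G n))
    (hG : ∀ n, ∀ A ∈ G n, DynSyndetic A) : ∃ A, DynCentralSyndetic A ∧ ∀ n, A ∉ G n := by
  have h : ∀ n l : ℕ, ∃ M : ℕ+, 0 < l → blockSet l ∩ {m | m ≤ M} ∈ dualFam (G n) := by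
    intro n l
    rcases Nat.eq_zero_or_pos l with rfl | hl
    · exact ⟨1, fun h => absurd h (lt_irrefl 0)⟩
    · have : NeZero l := ⟨hl.ne'⟩
      obtain ⟨M, hM⟩ := hc n (blockSet l) fun A hA => blockSet_mem_dualFam l A (hG n A hA)
      exact ⟨M, fun _ => hM⟩
  choose M hM using h
  let K : ℕ → ℕ → ℕ := fun n l => M n l
  have hK : ∀ n l, 0 < K n l := fun n l => (M n l).pos
  refine ⟨_, (limitSeq_prefixRecurrent hK).dynCentralSyndetic (limitSeq_zero hK), fun n hn => ?_⟩
  obtain ⟨m, ⟨⟨k, j, hj, hm⟩, hmM⟩, hmA⟩ :=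
    hM n _ ((Nat.zero_le n).trans_lt (lt_wordPair_length hK n)) _ hn
  have hmK : (m : ℕ) ≤ K n (wordPair K n).1.length := PNat.coe_le_coe _ _ |>.2 hmM
  have hk := le_blockStart (wordPair K n).1.length k
  have hf := limitSeq_eq_false hK n (k := k) (by omega) hj
  rw [← hm] at hf
  have ht : limitSeq K m = true := hmA
  simp [hf] at ht

/-- Neither the family of dynamically syndetic sets nor the family of dynamically central
syndetic sets is σ-compact. -/
theorem dynSyndetic_not_sigmaCompact :
    ¬ SigmaCompactFamily {A : Set ℕ+ | DynSyndetic A} ∧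
    ¬ SigmaCompactFamily {A : Set ℕ+ | DynCentralSyndetic A} := by
  constructor
  · rintro ⟨G, hG, h⟩
    obtain ⟨A, hA, hn⟩ := exists_dynCentralSyndetic_notMem (fun n => (hG n).2)
      fun n A hA => (h ▸ mem_iUnion_of_mem n hA : A ∈ {A | DynSyndetic A})
    have : A ∈ ⋃ n, G n := h ▸ hA.dynSyndetic
    obtain ⟨n, h⟩ := mem_iUnion.1 this
    exact hn n h
  · rintro ⟨G, hG, h⟩
    obtain ⟨A, hA, hn⟩ := exists_dynCentralSyndetic_notMem (fun n => (hG n).2)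
      fun n A hA => DynCentralSyndetic.dynSyndetic
        (h ▸ mem_iUnion_of_mem n hA : A ∈ {A | DynCentralSyndetic A})
    have : A ∈ ⋃ n, G n := h ▸ hA
    obtain ⟨n, h⟩ := mem_iUnion.1 this
    exact hn n h
end
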